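/- arXiv:math/0301090 — 6 statements merged into one kernel-verified Lean document; each statement's English description precedes it below -/
import Mathlib

section
/- Globalization lemma: Let R be a unital ring and {T_λ}_{λ∈Λ} a finite family of left Ore sets in R which covers R, in the sense that every left R-module N satisfying T_λ⁻¹N = 0 for all λ ∈ Λ is the zero module. Then for every left R-module M the sequence 0 → M → ∏_{λ∈Λ} T_λ⁻¹M → ∏_{(μ,ν)∈Λ×Λ} T_μ⁻¹T_ν⁻¹M is exact, where the first map sends m to (i_{T_λ,M}(m))_λ, the second map sends (m_λ)_λ to the family whose (μ,ν)-component is i^μ_{μ,ν}(m_μ) − i^ν_{μ,ν}(m_ν), T_μ⁻¹T_ν⁻¹M denotes the localization at T_μ of the R-module T_ν⁻¹M, i^ν_{μ,ν} : T_ν⁻¹M → T_μ⁻¹T_ν⁻¹M is its localization map, and i^μ_{μ,ν} : T_μ⁻¹M → T_μ⁻¹T_ν⁻¹M is the map obtained by localizing i_{T_ν,M} : M → T_ν⁻¹M at T_μ. Exactness means: the first map is injective and its image equals the kernel of the second map. -/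
universe u

/-- A multiplicative subset `S` of a unital ring `R` is a *left Ore set* if it satisfies
the left Ore condition and left reversibility. -/
structure IsLeftOreSet {R : Type u} [Ring R] (S : Set R) : Prop where
  one_mem : (1 : R) ∈ S
  mul_mem : ∀ ⦃s t : R⦄, s ∈ S → t ∈ S → s * t ∈ S
  zero_not_mem : (0 : R) ∉ S
  ore : ∀ s ∈ S, ∀ r : R, ∃ s' ∈ S, ∃ r' : R, r' * s = s' * r
  reversible : ∀ (n : R), ∀ s ∈ S, n * s = 0 → ∃ s' ∈ S, s' * n = 0

/-- `f : M →ₗ[R] N` realizes `N` as the left Ore localization `S⁻¹M = S⁻¹R ⊗_R M`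
of the left `R`-module `M` at the left Ore set `S`: every `s ∈ S` acts bijectively on `N`,
every element of `N` is a left fraction `s⁻¹ • f m`, and the kernel of `f` is the
`S`-torsion of `M`. -/
structure IsLeftOreModuleLocalization {R : Type u} [Ring R] (S : Set R)
    {M : Type u} {N : Type u} [AddCommGroup M] [Module R M] [AddCommGroup N] [Module R N]
    (f : M →ₗ[R] N) : Prop where
  smul_bijective : ∀ s ∈ S, Function.Bijective (fun n : N => s • n)
  surj : ∀ n : N, ∃ s ∈ S, ∃ m : M, s • n = f m
  ker : ∀ m : M, f m = 0 ↔ ∃ s ∈ S, s • m = 0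

/-- **Globalization lemma.** Let `{T l}` be a finite family of left Ore sets in `R` which
covers `R` (any left `R`-module all of whose localizations vanish — equivalently, which is
`T l`-torsion for each `l` — is zero).  For a left `R`-module `M`, let `f l : M → ML l` be
the localization of `M` at `T l`, let `g μ ν : ML ν → M2 μ ν` be the localization of the
module `ML ν` at `T μ`, and let `h μ ν : ML μ → M2 μ ν` be the map obtained by localizing
`f ν : M → ML ν` at `T μ`, i.e. the unique `R`-linear map with `h μ ν ∘ f μ = g μ ν ∘ f ν`.
Then `0 → M → ∏ l, ML l → ∏ (μ,ν), M2 μ ν` is exact: the map `m ↦ (f l m)_l` is injective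
and its image is exactly the kernel of `(x l)_l ↦ (h μ ν (x μ) - g μ ν (x ν))_{(μ,ν)}`. -/
theorem globalization_lemma
    {R : Type u} [Ring R] {Λ : Type u} [Finite Λ]
    (T : Λ → Set R) (hOre : ∀ l, IsLeftOreSet (T l))
    (hcover : ∀ (N : Type u) [AddCommGroup N] [Module R N],
      (∀ l, ∀ x : N, ∃ t ∈ T l, t • x = 0) → ∀ x : N, x = 0)
    (M : Type u) [AddCommGroup M] [Module R M]
    (ML : Λ → Type u) [∀ l, AddCommGroup (ML l)] [∀ l, Module R (ML l)]
    (f : ∀ l, M →ₗ[R] ML l)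
    (hf : ∀ l, IsLeftOreModuleLocalization (T l) (f l))
    (M2 : Λ → Λ → Type u) [∀ μ ν, AddCommGroup (M2 μ ν)] [∀ μ ν, Module R (M2 μ ν)]
    (g : ∀ μ ν, ML ν →ₗ[R] M2 μ ν)
    (hg : ∀ μ ν, IsLeftOreModuleLocalization (T μ) (g μ ν))
    (h : ∀ μ ν, ML μ →ₗ[R] M2 μ ν)
    (hh : ∀ μ ν, (h μ ν).comp (f μ) = (g μ ν).comp (f ν)) :
    Function.Injective (fun m : M => fun l => f l m) ∧
      ∀ x : ∀ l, ML l,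
        (∀ μ ν, h μ ν (x μ) - g μ ν (x ν) = 0) ↔ ∃ m : M, (fun l => f l m) = x := by
  have key : ∀ μ (z : ∀ l, ML l), (∀ ν, g μ ν (z ν) = 0) → ∃ t ∈ T μ, t • z = 0 := by
    classical
    intro μ z hz
    have := Fintype.ofFinite Λ
    have aux : ∀ F : Finset Λ, ∃ t ∈ T μ, ∀ ν ∈ F, t • z ν = 0 := by
      intro F
      induction F using Finset.induction_on with
      | empty => exact ⟨1, (hOre μ).one_mem, by simp⟩
      | insert a F _ ih =>
        obtain ⟨t, ht, htF⟩ := ih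
        obtain ⟨t', ht', hta⟩ := ((hg μ a).ker (t • z a)).1 (by rw [map_smul, hz, smul_zero])
        refine ⟨t' * t, (hOre μ).mul_mem ht' ht, ?_⟩
        intro ν hν
        rcases Finset.mem_insert.1 hν with rfl | hν
        · rw [mul_smul, hta]
        · rw [mul_smul, htF ν hν, smul_zero]
    obtain ⟨t, ht, h1⟩ := aux Finset.univ
    exact ⟨t, ht, funext fun ν => h1 ν (Finset.mem_univ _)⟩
  have hh' : ∀ μ ν m, h μ ν (f μ m) = g μ ν (f ν m) := fun μ ν m =>
    LinearMap.congr_fun (hh μ ν) m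
  refine ⟨?_, ?_⟩
  · have hι : Function.Injective (LinearMap.pi f) := by
      rw [← LinearMap.ker_eq_bot, Submodule.eq_bot_iff]
      intro m hm
      have := hcover (LinearMap.ker (LinearMap.pi f)) (by
        rintro l ⟨x, hx⟩
        have hx' : f l x = 0 := congrFun (LinearMap.mem_ker.1 hx) l
        obtain ⟨t, ht, h0⟩ := ((hf l).ker x).1 hx'
        exact ⟨t, ht, Subtype.ext h0⟩) ⟨m, hm⟩
      exact congrArg Subtype.val this
    exact hι
  · intro x
    constructor
    · intro hx
      let P : Submodule R (∀ l, ML l) :=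
        { carrier := {y | ∀ μ ν, h μ ν (y μ) = g μ ν (y ν)}
          add_mem' := by
            intro a b ha hb μ ν
            simp only [Pi.add_apply, map_add, ha μ ν, hb μ ν]
          zero_mem' := by intro μ ν; simp
          smul_mem' := by
            intro c a ha μ ν
            simp only [Pi.smul_apply, map_smul, ha μ ν] }
      let Q : Submodule R P := (LinearMap.range (LinearMap.pi f)).comap P.subtype
      have h0 := hcover (P ⧸ Q) (by
        intro μ q
        obtain ⟨⟨y, hy⟩, rfl⟩ := Submodule.Quotient.mk_surjective Q q
        obtain ⟨s, hs, m, hm⟩ := (hf μ).surj (y μ)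
        obtain ⟨t, ht, hz⟩ := key μ (s • y - LinearMap.pi f m) (by
          intro ν
          have e : g μ ν (s • y ν - f ν m) = h μ ν (s • y μ - f μ m) := by
            rw [map_sub, map_sub, map_smul, map_smul, hy μ ν, hh']
          have e2 : g μ ν (s • y ν - f ν m) = 0 := by rw [e, hm, sub_self, map_zero]
          exact e2)
        refine ⟨t * s, (hOre μ).mul_mem ht hs, ?_⟩
        rw [← Submodule.Quotient.mk_smul, Submodule.Quotient.mk_eq_zero]
        refine ⟨t • m, ?_⟩
        rw [smul_sub, sub_eq_zero] at hz
        rw [map_smul, ← hz, ← mul_smul]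
        rfl) (Submodule.Quotient.mk ⟨x, fun μ ν => sub_eq_zero.1 (hx μ ν)⟩)
      rw [Submodule.Quotient.mk_eq_zero] at h0
      obtain ⟨m, hm⟩ := h0
      exact ⟨m, hm⟩
    · rintro ⟨m, rfl⟩ μ ν
      exact sub_eq_zero.2 (hh' μ ν m)
end

section
/- Theorem 3: Let k be a field, B a Hopf algebra over k with antipode S, (E,ρ) a right B-comodule algebra, and (M,ρ_M) a left B-comodule. Let {T_λ}_{λ∈Λ} be a finite family of ρ-compatible left Ore sets in E, with localized coactions ρ_λ on E_λ := T_λ⁻¹E, which covers E in the sense that every left E-module N with T_λ⁻¹N = 0 for all λ is zero. Suppose for each λ a B-comodule algebra homomorphism γ_λ : B → E_λ is given (a k-algebra homomorphism with ρ_λ ∘ γ_λ = (γ_λ ⊗ id_B) ∘ Δ). Define κ_λ : E_λ^{coB} ⊗ M → E_λ ⊗ M by κ_λ(f ⊗ m) = Σ f·γ_λ(m₍₋₁₎) ⊗ m₍₀₎, and let Γξ_M be the k-vector space of families F = (F_λ)_λ ∈ ∏_λ (E_λ^{coB} ⊗ M) such that for every ordered pair (λ,λ') the elements (i^λ_{λ,λ'}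 ⊗ id_M)(κ_λ F_λ) and (i^{λ'}_{λ,λ'} ⊗ id_M)(κ_{λ'} F_{λ'}) of (T_λ⁻¹T_{λ'}⁻¹E) ⊗ M coincide, where T_λ⁻¹T_{λ'}⁻¹E denotes the localization at T_λ of the E-module T_{λ'}⁻¹E, i^{λ'}_{λ,λ'} is its localization map, and i^λ_{λ,λ'} is obtained by localizing i_{λ'} : E → E_{λ'} at T_λ. Then the assignment H ↦ (κ_λ⁻¹((i_λ ⊗ id_M)(H)))_λ is a well-defined k-linear bijection from the cotensor product E □_B M = {H ∈ E ⊗ M : (ρ ⊗ id_M)(H) = (id_E ⊗ ρ_M)(H)} onto Γξ_M. -/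
open scoped TensorProduct

universe u

/-- `i : R →+* Q` realizes `Q` as the left Ore localization `S⁻¹R`. -/
structure IsLeftOreRingLocalization {R : Type u} [Ring R] (S : Set R)
    {Q : Type u} [Ring Q] (i : R →+* Q) : Prop where
  isUnit : ∀ s ∈ S, IsUnit (i s)
  surj : ∀ x : Q, ∃ s ∈ S, ∃ r : R, i s * x = i r
  ker : ∀ r : R, i r = 0 ↔ ∃ s ∈ S, s * r = 0

/-- `(E, ρ)` is a right `B`-comodule algebra. -/
structure IsComoduleAlgebra (k : Type u) [CommRing k]
    (B : Type u) [Ring B] [Bialgebra k B]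
    {E : Type u} [Ring E] [Algebra k E]
    (ρ : E →ₐ[k] E ⊗[k] B) : Prop where
  coassoc : ∀ e : E,
      TensorProduct.assoc k E B B (TensorProduct.map ρ.toLinearMap LinearMap.id (ρ e))
        = TensorProduct.map LinearMap.id (Coalgebra.comul (R := k) (A := B)) (ρ e)
  counit : ∀ e : E,
      TensorProduct.rid k E
        (TensorProduct.map LinearMap.id (Coalgebra.counit (R := k) (A := B)) (ρ e)) = e

/-- `(M, ρM)` is a left `B`-comodule. -/
structure IsLeftComodule (k : Type u) [CommRing k]
    (B : Type u) [Ring B] [Bialgebra k B]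
    {M : Type u} [AddCommGroup M] [Module k M]
    (ρM : M →ₗ[k] B ⊗[k] M) : Prop where
  coassoc : ∀ m : M,
      TensorProduct.map (Coalgebra.comul (R := k) (A := B)) LinearMap.id (ρM m)
        = (TensorProduct.assoc k B B M).symm (TensorProduct.map LinearMap.id ρM (ρM m))
  counit : ∀ m : M,
      TensorProduct.lid k M
        (TensorProduct.map (Coalgebra.counit (R := k) (A := B)) LinearMap.id (ρM m)) = m

/-- The coinvariants `A^{co B}` of a right `B`-comodule algebra, as a `k`-submodule. -/
def coinvariants (k : Type u) [CommRing k] {B : Type u} [Ring B] [Bialgebra k B]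
    {A : Type u} [Ring A] [Algebra k A] (ρ : A →ₐ[k] A ⊗[k] B) : Submodule k A where
  carrier := {a | ρ a = a ⊗ₜ[k] (1 : B)}
  add_mem' := by
    intro a b ha hb
    simp only [Set.mem_setOf_eq] at *
    rw [map_add, ha, hb, TensorProduct.add_tmul]
  zero_mem' := by
    simp only [Set.mem_setOf_eq, map_zero, TensorProduct.zero_tmul]
  smul_mem' := by
    intro c a ha
    simp only [Set.mem_setOf_eq] at *
    rw [map_smul, ha, TensorProduct.smul_tmul']

/-- The map `κ : A^{co B} ⊗ M → A ⊗ M`, `f ⊗ m ↦ Σ f·γ(m₍₋₁₎) ⊗ m₍₀₎`. -/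
noncomputable def kappaCoinv (k : Type u) [CommRing k]
    {B : Type u} [Ring B] [Bialgebra k B]
    {A : Type u} [Ring A] [Algebra k A] (ρA : A →ₐ[k] A ⊗[k] B)
    {M : Type u} [AddCommGroup M] [Module k M] (ρM : M →ₗ[k] B ⊗[k] M)
    (γ : B →ₐ[k] A) :
    (coinvariants k ρA) ⊗[k] M →ₗ[k] A ⊗[k] M :=
  (TensorProduct.map
      ((LinearMap.mul' k A) ∘ₗ
        TensorProduct.map (coinvariants k ρA).subtype γ.toLinearMap)
      LinearMap.id) ∘ₗ
    ((TensorProduct.assoc k (coinvariants k ρA) B M).symm.toLinearMap) ∘ₗ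
    (TensorProduct.map LinearMap.id ρM)

/-- The cotensor product `E □_B M`, as a `k`-submodule of `E ⊗ M`. -/
noncomputable def cotensorSubmodule (k : Type u) [CommRing k] {B : Type u} [Ring B] [Bialgebra k B]
    {E : Type u} [Ring E] [Algebra k E] (ρ : E →ₐ[k] E ⊗[k] B)
    {M : Type u} [AddCommGroup M] [Module k M] (ρM : M →ₗ[k] B ⊗[k] M) :
    Submodule k (E ⊗[k] M) :=
  LinearMap.ker
    (((TensorProduct.assoc k E B M).toLinearMap ∘ₗ
        TensorProduct.map ρ.toLinearMap LinearMap.id)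
      - TensorProduct.map LinearMap.id ρM)

section Helpers

open Coalgebra WithConv

section Act
variable {k : Type u} [CommRing k] {B : Type u} [Ring B] [Bialgebra k B]
  {A : Type u} [Ring A] [Algebra k A] {D : Type u} [Ring D] [Algebra k D]

/-- right convolution action -/
noncomputable def ract (ρ : A →ₐ[k] A ⊗[k] B) (f : A →ₗ[k] D) (v : WithConv (B →ₗ[k] D)) :
    A →ₗ[k] D :=
  LinearMap.mul' k D ∘ₗ TensorProduct.map f v.ofConv ∘ₗ ρ.toLinearMap

lemma ract_ract {ρ : A →ₐ[k] A ⊗[k] B} (hρ : IsComoduleAlgebra k B ρ) (f : A →ₗ[k] D)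
    (v w : WithConv (B →ₗ[k] D)) : ract ρ (ract ρ f v) w = ract ρ f (v * w) := by
  ext a
  have h1 : ∀ x : A ⊗[k] B, LinearMap.mul' k D (TensorProduct.map (ract ρ f v) w.ofConv x) =
      (LinearMap.mul' k D ∘ₗ TensorProduct.map f (LinearMap.mul' k D ∘ₗ
        TensorProduct.map v.ofConv w.ofConv)) (TensorProduct.assoc k A B B
          (TensorProduct.map ρ.toLinearMap LinearMap.id x)) := by
    intro x
    induction x with
    | zero => simp
    | add x y hx hy => simp only [map_add, hx, hy]
    | tmul x y =>
      simp only [TensorProduct.map_tmul, ract, LinearMap.comp_apply, AlgHom.toLinearMap_apply,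
        LinearMap.id_apply]
      induction ρ x with
      | zero => simp
      | add x y hx hy => simp only [map_add, TensorProduct.add_tmul, hx, hy]
      | tmul x z => simp [mul_assoc]
  have h2 : ∀ x : A ⊗[k] B, LinearMap.mul' k D (TensorProduct.map f (v * w).ofConv x) =
      (LinearMap.mul' k D ∘ₗ TensorProduct.map f (LinearMap.mul' k D ∘ₗ
        TensorProduct.map v.ofConv w.ofConv))
          (TensorProduct.map LinearMap.id (Coalgebra.comul (R := k) (A := B)) x) := by
    intro x
    induction x with
    | zero => simp
    | add x y hx hy => simp only [map_add, hx, hy]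
    | tmul x y => simp [LinearMap.convMul_def]
  change LinearMap.mul' k D (TensorProduct.map (ract ρ f v) w.ofConv (ρ a)) =
    LinearMap.mul' k D (TensorProduct.map f (v * w).ofConv (ρ a))
  rw [h1, h2, hρ.coassoc]

lemma ract_one {ρ : A →ₐ[k] A ⊗[k] B} (hρ : IsComoduleAlgebra k B ρ) (f : A →ₗ[k] D) :
    ract ρ f 1 = f := by
  ext a
  have h1 : ∀ x : A ⊗[k] B, LinearMap.mul' k D (TensorProduct.map f
      (1 : WithConv (B →ₗ[k] D)).ofConv x) = f (TensorProduct.rid k A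
        (TensorProduct.map LinearMap.id (Coalgebra.counit (R := k) (A := B)) x)) := by
    intro x
    induction x with
    | zero => simp
    | add x y hx hy => simp only [map_add, hx, hy]
    | tmul x y =>
      simp [LinearMap.convOne_def]
      rw [← Algebra.commutes, ← Algebra.smul_def]
  exact (h1 (ρ a)).trans (by rw [hρ.counit])

lemma comp_ract {D' : Type u} [Ring D'] [Algebra k D'] (ρ : A →ₐ[k] A ⊗[k] B) (f : A →ₗ[k] D)
    (v : WithConv (B →ₗ[k] D)) (h : D →ₐ[k] D') :
    h.toLinearMap ∘ₗ ract ρ f v = ract ρ (h.toLinearMap ∘ₗ f) (toConv (h.toLinearMap ∘ₗ v.ofConv)) := by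
  ext a
  simp only [ract, LinearMap.comp_apply, AlgHom.toLinearMap_apply]
  induction ρ a with
  | zero => simp
  | add x y hx hy => simp only [map_add, hx, hy]
  | tmul x z => simp

variable {M : Type u} [AddCommGroup M] [Module k M]

/-- twisting by a convolution element -/
noncomputable def lact (ρM : M →ₗ[k] B ⊗[k] M) (v : WithConv (B →ₗ[k] A)) :
    A ⊗[k] M →ₗ[k] A ⊗[k] M :=
  (TensorProduct.map (LinearMap.mul' k A ∘ₗ TensorProduct.map LinearMap.id v.ofConv)
      LinearMap.id) ∘ₗ ((TensorProduct.assoc k A B M).symm.toLinearMap) ∘ₗ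
    (TensorProduct.map LinearMap.id ρM)

lemma lact_lact {ρM : M →ₗ[k] B ⊗[k] M} (hM : IsLeftComodule k B ρM)
    (v w : WithConv (B →ₗ[k] A)) (x : A ⊗[k] M) :
    lact ρM w (lact ρM v x) = lact ρM (v * w) x := by
  induction x with
  | zero => simp
  | add x y hx hy => simp only [map_add, hx, hy]
  | tmul a m =>
    let Ψ : (B ⊗[k] B) ⊗[k] M →ₗ[k] A ⊗[k] M := TensorProduct.map
      (LinearMap.mulLeft k a ∘ₗ LinearMap.mul' k A ∘ₗ TensorProduct.map v.ofConv w.ofConv)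
      LinearMap.id
    have h1 : lact ρM w (lact ρM v (a ⊗ₜ m)) =
        Ψ ((TensorProduct.assoc k B B M).symm (TensorProduct.map LinearMap.id ρM (ρM m))) := by
      simp only [lact, LinearMap.comp_apply, LinearEquiv.coe_coe, TensorProduct.map_tmul,
        LinearMap.id_apply]
      induction ρM m with
      | zero => simp
      | add x y hx hy => simp only [map_add, TensorProduct.tmul_add, hx, hy]
      | tmul b n =>
        simp only [TensorProduct.map_tmul, LinearMap.id_apply, TensorProduct.assoc_symm_tmul,
          LinearMap.comp_apply, LinearMap.mul'_apply]
        induction ρM n with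
        | zero => simp
        | add x y hx hy => simp only [map_add, TensorProduct.tmul_add, hx, hy]
        | tmul b n => simp [Ψ, mul_assoc]
    have h2 : lact ρM (v * w) (a ⊗ₜ m) =
        Ψ (TensorProduct.map (Coalgebra.comul (R := k) (A := B)) LinearMap.id (ρM m)) := by
      simp only [lact, LinearMap.comp_apply, LinearEquiv.coe_coe, TensorProduct.map_tmul,
        LinearMap.id_apply]
      induction ρM m with
      | zero => simp
      | add x y hx hy => simp only [map_add, TensorProduct.tmul_add, hx, hy]
      | tmul b n => simp [Ψ, LinearMap.convMul_def]
    rw [h1, h2, hM.coassoc]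

lemma lact_one {ρM : M →ₗ[k] B ⊗[k] M} (hM : IsLeftComodule k B ρM) (x : A ⊗[k] M) :
    lact ρM 1 x = x := by
  induction x with
  | zero => simp
  | add x y hx hy => simp only [map_add, hx, hy]
  | tmul a m =>
    have h1 : lact ρM 1 (a ⊗ₜ m) = a ⊗ₜ[k] (TensorProduct.lid k M
        (TensorProduct.map (Coalgebra.counit (R := k) (A := B)) LinearMap.id (ρM m))) := by
      simp only [lact, LinearMap.comp_apply, LinearEquiv.coe_coe, TensorProduct.map_tmul,
        LinearMap.id_apply]
      induction ρM m with
      | zero => simp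
      | add x y hx hy => simp only [map_add, TensorProduct.tmul_add, hx, hy]
      | tmul b n =>
        simp [LinearMap.convOne_def]
        rw [← Algebra.commutes, ← Algebra.smul_def, TensorProduct.smul_tmul']
    rw [h1, hM.counit]

lemma kappaCoinv_eq (ρA : A →ₐ[k] A ⊗[k] B) (ρM : M →ₗ[k] B ⊗[k] M) (γ : B →ₐ[k] A)
    (x : (coinvariants k ρA) ⊗[k] M) :
    kappaCoinv k ρA ρM γ x = lact ρM (toConv γ.toLinearMap)
      (TensorProduct.map (coinvariants k ρA).subtype LinearMap.id x) := by
  induction x with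
  | zero => simp
  | add x y hx hy => simp only [map_add, hx, hy]
  | tmul a m =>
    simp only [lact, kappaCoinv, LinearMap.comp_apply, LinearEquiv.coe_coe, TensorProduct.map_tmul,
      LinearMap.id_apply]
    induction ρM m with
    | zero => simp
    | add x y hx hy => simp only [map_add, TensorProduct.tmul_add, hx, hy]
    | tmul b n => simp

lemma mem_cotensor (ρ : A →ₐ[k] A ⊗[k] B) (ρM : M →ₗ[k] B ⊗[k] M) (x : A ⊗[k] M) :
    x ∈ cotensorSubmodule k ρ ρM ↔ TensorProduct.assoc k A B M
      (TensorProduct.map ρ.toLinearMap LinearMap.id x) = TensorProduct.map LinearMap.id ρM x := by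
  simp [cotensorSubmodule, sub_eq_zero]

lemma kappa_mem (ρA : A →ₐ[k] A ⊗[k] B) {ρM : M →ₗ[k] B ⊗[k] M} (hM : IsLeftComodule k B ρM)
    (γ : B →ₐ[k] A)
    (hγ : ∀ b : B, ρA (γ b) =
      TensorProduct.map γ.toLinearMap LinearMap.id (Coalgebra.comul (R := k) (A := B) b))
    (x : (coinvariants k ρA) ⊗[k] M) :
    kappaCoinv k ρA ρM γ x ∈ cotensorSubmodule k ρA ρM := by
  induction x with
  | zero => simp
  | add x y hx hy => rw [map_add]; exact add_mem hx hy
  | tmul a m =>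
    rw [mem_cotensor]
    let Ψ : (B ⊗[k] B) ⊗[k] M →ₗ[k] A ⊗[k] (B ⊗[k] M) :=
      (TensorProduct.map (LinearMap.mulLeft k (a : A) ∘ₗ γ.toLinearMap) LinearMap.id) ∘ₗ
        (TensorProduct.assoc k B B M).toLinearMap
    have ha : ρA (a : A) = (a : A) ⊗ₜ[k] (1 : B) := a.2
    have h1 : TensorProduct.assoc k A B M (TensorProduct.map ρA.toLinearMap LinearMap.id
        (kappaCoinv k ρA ρM γ (a ⊗ₜ m))) =
        Ψ (TensorProduct.map (Coalgebra.comul (R := k) (A := B)) LinearMap.id (ρM m)) := by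
      simp only [kappaCoinv, LinearMap.comp_apply, LinearEquiv.coe_coe, TensorProduct.map_tmul,
        LinearMap.id_apply]
      induction ρM m with
      | zero => simp
      | add x y hx hy => simp only [map_add, TensorProduct.tmul_add, hx, hy]
      | tmul b n =>
        simp only [TensorProduct.map_tmul, LinearMap.id_apply, TensorProduct.assoc_symm_tmul,
          LinearMap.comp_apply, LinearMap.mul'_apply, AlgHom.toLinearMap_apply, map_mul, hγ,
          Submodule.subtype_apply, ha]
        induction (Coalgebra.comul (R := k) (A := B) b) with
        | zero => simp
        | add x y hx hy => simp only [map_add, TensorProduct.add_tmul, mul_add, hx, hy]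
        | tmul b n => simp [Ψ]
    have h2 : TensorProduct.map LinearMap.id ρM (kappaCoinv k ρA ρM γ (a ⊗ₜ m)) =
        Ψ ((TensorProduct.assoc k B B M).symm (TensorProduct.map LinearMap.id ρM (ρM m))) := by
      simp only [kappaCoinv, LinearMap.comp_apply, LinearEquiv.coe_coe, TensorProduct.map_tmul,
        LinearMap.id_apply]
      induction ρM m with
      | zero => simp
      | add x y hx hy => simp only [map_add, TensorProduct.tmul_add, hx, hy]
      | tmul b n => simp [Ψ]
    rw [h1, h2, hM.coassoc]

lemma ract_cotensor (ρ : A →ₐ[k] A ⊗[k] B) (ρM : M →ₗ[k] B ⊗[k] M) (v : WithConv (B →ₗ[k] A))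
    (x : A ⊗[k] M) (hx : x ∈ cotensorSubmodule k ρ ρM) :
    TensorProduct.map (ract ρ LinearMap.id v) LinearMap.id x = lact ρM v x := by
  rw [mem_cotensor] at hx
  simp only [lact, LinearMap.comp_apply, ← hx, LinearEquiv.coe_coe, LinearEquiv.symm_apply_apply]
  rw [← LinearMap.comp_apply, ← TensorProduct.map_comp]
  rfl

end Act

section Hopf
variable {k : Type u} [CommRing k] {B : Type u} [Ring B] [HopfAlgebra k B]
  {A : Type u} [Ring A] [Algebra k A]

lemma conv_inv_left (γ : B →ₐ[k] A) :
    toConv (γ.toLinearMap ∘ₗ HopfAlgebra.antipode k) * toConv γ.toLinearMap = 1 := by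
  have := LinearMap.algHom_comp_convMul_distrib γ (toConv (HopfAlgebra.antipode k (A := B)))
    (toConv LinearMap.id)
  rw [LinearMap.antipode_mul_id] at this
  apply WithConv.ofConv_injective
  refine this.symm.trans ?_
  ext b; simp [LinearMap.convOne_def]

lemma conv_inv_right (γ : B →ₐ[k] A) :
    toConv γ.toLinearMap * toConv (γ.toLinearMap ∘ₗ HopfAlgebra.antipode k) = 1 := by
  have := LinearMap.algHom_comp_convMul_distrib γ
    (toConv LinearMap.id) (toConv (HopfAlgebra.antipode k (A := B)))
  rw [LinearMap.id_mul_antipode] at this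
  apply WithConv.ofConv_injective
  refine this.symm.trans ?_
  ext b; simp [LinearMap.convOne_def]

lemma ract_coinv {ρ : A →ₐ[k] A ⊗[k] B} (hρ : IsComoduleAlgebra k B ρ) (γ : B →ₐ[k] A)
    (hγ : ∀ b : B, ρ (γ b) =
      TensorProduct.map γ.toLinearMap LinearMap.id (Coalgebra.comul (R := k) (A := B) b)) (a : A) :
    ract ρ LinearMap.id (toConv (γ.toLinearMap ∘ₗ HopfAlgebra.antipode k)) a
      ∈ coinvariants k ρ := by
  let j : A →ₐ[k] A ⊗[k] B := Algebra.TensorProduct.includeLeft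
  let r : B →ₐ[k] A ⊗[k] B := Algebra.TensorProduct.includeRight
  have e1 : toConv (ρ.comp γ).toLinearMap = toConv (j.comp γ).toLinearMap * toConv r.toLinearMap := by
    apply WithConv.ofConv_injective
    ext b
    simp only [LinearMap.convMul_def, LinearMap.comp_apply, AlgHom.toLinearMap_apply,
      AlgHom.comp_apply, hγ]
    induction (Coalgebra.comul (R := k) (A := B) b) with
    | zero => simp
    | add x y hx hy => simp only [map_add, hx, hy]
    | tmul b n => simp [j, r]
  have e2 : ρ.toLinearMap = ract ρ j.toLinearMap (toConv r.toLinearMap) := by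
    ext a
    simp only [ract, LinearMap.comp_apply, AlgHom.toLinearMap_apply]
    induction ρ a with
    | zero => simp
    | add x y hx hy => rw [map_add, map_add, ← hx, ← hy]
    | tmul b n => simp [j, r]
  have e3 : ρ.toLinearMap ∘ₗ ract ρ LinearMap.id (toConv (γ.toLinearMap ∘ₗ HopfAlgebra.antipode k))
      = j.toLinearMap ∘ₗ ract ρ LinearMap.id (toConv (γ.toLinearMap ∘ₗ HopfAlgebra.antipode k)) := by
    rw [comp_ract, comp_ract]
    change ract ρ ρ.toLinearMap (toConv ((ρ.comp γ).toLinearMap ∘ₗ HopfAlgebra.antipode k)) =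
      ract ρ j.toLinearMap (toConv ((j.comp γ).toLinearMap ∘ₗ HopfAlgebra.antipode k))
    have e4 : ρ.toLinearMap = ract ρ (ract ρ j.toLinearMap
        (toConv ((j.comp γ).toLinearMap ∘ₗ HopfAlgebra.antipode k)))
          (toConv (ρ.comp γ).toLinearMap) := by
      rw [ract_ract hρ, e1, ← mul_assoc, conv_inv_left, one_mul, ← e2]
    conv_lhs => rw [e4]
    rw [ract_ract hρ, conv_inv_right, ract_one hρ]
  exact LinearMap.congr_fun e3 a

end Hopf

section Glue

lemma common_denom {E : Type u} [Ring E] {T : Set E} (hT : IsLeftOreSet T) {ι : Type u}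
    (s : Finset ι) (t : ι → E) (ht : ∀ a, t a ∈ T) : ∃ c ∈ T, ∀ a ∈ s, ∃ r, c = r * t a := by
  classical
  induction s using Finset.induction_on with
  | empty => exact ⟨1, hT.one_mem, by simp⟩
  | insert a s ha ih =>
    obtain ⟨c, hc, h⟩ := ih
    obtain ⟨s', hs', r', hr⟩ := hT.ore (t a) (ht a) c
    refine ⟨s' * c, hT.mul_mem hs' hc, fun b hb => ?_⟩
    rcases Finset.mem_insert.1 hb with rfl | hb
    · exact ⟨r', hr.symm⟩
    · obtain ⟨r, hr⟩ := h b hb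
      exact ⟨s' * r, by rw [mul_assoc, ← hr]⟩

variable {E : Type u} [Ring E] {Λ : Type u} [Finite Λ]
    (T : Λ → Set E) (hT : ∀ l, IsLeftOreSet (T l))
    (hcover : ∀ (N : Type u) [AddCommGroup N] [Module E N],
      (∀ l, ∀ x : N, ∃ t ∈ T l, t • x = 0) → ∀ x : N, x = 0)
    (Q : Λ → Type u) [∀ l, AddCommGroup (Q l)] [∀ l, Module E (Q l)]
    (i : ∀ l, E →ₗ[E] Q l)

include hcover in
lemma glue_inj (hker : ∀ l r, i l r = 0 → ∃ t ∈ T l, t * r = 0) (e : E)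
    (he : ∀ l, i l e = 0) : e = 0 := by
  have := hcover (LinearMap.ker (LinearMap.pi i)) (fun l x => by
    obtain ⟨t, ht, h⟩ := hker l x.1 (congrFun (LinearMap.mem_ker.1 x.2) l)
    exact ⟨t, ht, Subtype.ext h⟩) ⟨e, LinearMap.mem_ker.2 (funext he)⟩
  exact congrArg Subtype.val this

include hT hcover in
lemma glue_surj (hsurj : ∀ l (x : Q l), ∃ t ∈ T l, ∃ r, t • x = i l r)
    (E2 : Λ → Λ → Type u) [∀ μ ν, AddCommGroup (E2 μ ν)] [∀ μ ν, Module E (E2 μ ν)]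
    (g : ∀ μ ν, Q ν →ₗ[E] E2 μ ν) (h2 : ∀ μ ν, Q μ →ₗ[E] E2 μ ν)
    (hg_ker : ∀ μ ν, ∀ x : Q ν, g μ ν x = 0 → ∃ t ∈ T μ, t • x = 0)
    (hc : ∀ μ ν, ∀ e : E, h2 μ ν (i μ e) = g μ ν (i ν e))
    (x : ∀ l, Q l) (hx : ∀ μ ν, h2 μ ν (x μ) = g μ ν (x ν)) : ∃ e, ∀ l, i l e = x l := by
  cases nonempty_fintype Λ
  let R : Submodule E (∀ l, Q l) := LinearMap.range (LinearMap.pi i)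
  let W : Submodule E (∀ l, Q l) := 
    { carrier := {x | ∀ μ ν, h2 μ ν (x μ) = g μ ν (x ν)}
      add_mem' := fun {a b} ha hb μ ν => by simp [ha μ ν, hb μ ν]
      zero_mem' := fun μ ν => by simp
      smul_mem' := fun c a ha μ ν => by simp [ha μ ν] }
  have key := hcover (W.map R.mkQ) (by
    rintro l ⟨_, x, hx, rfl⟩
    replace hx : ∀ μ ν, h2 μ ν (x μ) = g μ ν (x ν) := hx
    obtain ⟨t, ht, e, hte⟩ := hsurj l (x l)
    have : ∀ ν, ∃ s ∈ T l, s • (t • x ν - i ν e) = 0 := by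
      intro ν
      apply hg_ker l ν
      rw [map_sub, map_smul, ← hx l ν, ← hc, ← map_smul, hte, sub_self]
    choose s hs hs0 using this
    obtain ⟨c, hcT, hcs⟩ := common_denom (hT l) Finset.univ s hs
    refine ⟨c * t, (hT l).mul_mem hcT ht, Subtype.ext ?_⟩
    change (c * t) • R.mkQ x = 0
    rw [← map_smul, Submodule.mkQ_apply, Submodule.Quotient.mk_eq_zero]
    refine ⟨c * e, funext fun ν => ?_⟩
    obtain ⟨r, hr⟩ := hcs ν (Finset.mem_univ _)
    have h3 : c • (t • x ν - i ν e) = 0 := by rw [hr, mul_smul, hs0, smul_zero]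
    rw [smul_sub, sub_eq_zero] at h3
    change i ν (c * e) = (c * t) • x ν
    rw [mul_smul, h3, ← smul_eq_mul, map_smul])
    ⟨R.mkQ x, x, hx, rfl⟩
  have k2 : R.mkQ x = 0 := congrArg Subtype.val key
  rw [Submodule.mkQ_apply, Submodule.Quotient.mk_eq_zero] at k2
  obtain ⟨e, he⟩ := k2
  exact ⟨e, fun l => congrFun he l⟩

end Glue

section Tensor
variable {k : Type u} [Field k] {M : Type u} [AddCommGroup M] [Module k M]

lemma pi_tensor_ext {ι : Type u} [Finite ι] (V : ι → Type u) [∀ a, AddCommGroup (V a)]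
    [∀ a, Module k (V a)] (x : (∀ a, V a) ⊗[k] M)
    (hx : ∀ a, (LinearMap.proj a : (∀ a, V a) →ₗ[k] V a).rTensor M x = 0) : x = 0 := by
  classical
  cases nonempty_fintype ι
  have h : (∑ a, LinearMap.single k V a ∘ₗ LinearMap.proj a) = LinearMap.id := by
    ext v a
    simp [LinearMap.sum_apply, Finset.sum_apply, Pi.single_apply]
  have h2 : (∑ a, LinearMap.single k V a ∘ₗ LinearMap.proj a).rTensor M x = x := by
    rw [h]; simp
  rw [← h2, ← LinearMap.coe_rTensorHom, map_sum, LinearMap.sum_apply]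
  refine Finset.sum_eq_zero fun a _ => ?_
  rw [LinearMap.coe_rTensorHom, LinearMap.rTensor_comp, LinearMap.comp_apply, hx, map_zero]

variable {V : Type u} [AddCommGroup V] [Module k V] {Λ : Type u} [Finite Λ]
   (Q : Λ → Type u) [∀ a, AddCommGroup (Q a)] [∀ a, Module k (Q a)] (i : ∀ l, V →ₗ[k] Q l)

lemma tensor_inj (hi : ∀ v, (∀ l, i l v = 0) → v = 0) (x y : V ⊗[k] M)
    (hx : ∀ l, TensorProduct.map (i l) LinearMap.id x = TensorProduct.map (i l) LinearMap.id y) :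
    x = y := by
  have hinj : Function.Injective (LinearMap.pi i) := by
    rw [injective_iff_map_eq_zero]
    exact fun v hv => hi v fun l => congrFun hv l
  apply Module.Flat.rTensor_preserves_injective_linearMap (M := M) (LinearMap.pi i) hinj
  rw [← sub_eq_zero, ← map_sub]
  apply pi_tensor_ext
  intro a
  rw [← LinearMap.comp_apply, ← LinearMap.rTensor_comp, LinearMap.proj_pi, map_sub, sub_eq_zero]
  exact hx a

lemma tensor_glue (E2 : Λ → Λ → Type u) [∀ μ ν, AddCommGroup (E2 μ ν)] [∀ μ ν, Module k (E2 μ ν)]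
    (g : ∀ μ ν, Q ν →ₗ[k] E2 μ ν) (h2 : ∀ μ ν, Q μ →ₗ[k] E2 μ ν)
    (hc : ∀ μ ν, ∀ e, h2 μ ν (i μ e) = g μ ν (i ν e))
    (hglue : ∀ x : ∀ l, Q l, (∀ μ ν, h2 μ ν (x μ) = g μ ν (x ν)) → ∃ e, ∀ l, i l e = x l)
    (F : ∀ l, Q l ⊗[k] M)
    (hF : ∀ μ ν, TensorProduct.map (h2 μ ν) LinearMap.id (F μ) =
      TensorProduct.map (g μ ν) LinearMap.id (F ν)) :
    ∃ H : V ⊗[k] M, ∀ l, TensorProduct.map (i l) LinearMap.id H = F l := by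
  classical
  cases nonempty_fintype Λ
  let d : (∀ l, Q l) →ₗ[k] (∀ p : Λ × Λ, E2 p.1 p.2) :=
    LinearMap.pi fun p => h2 p.1 p.2 ∘ₗ LinearMap.proj p.1 - g p.1 p.2 ∘ₗ LinearMap.proj p.2
  have hex : Function.Exact (LinearMap.pi i) d := by
    intro x
    constructor
    · intro hx
      obtain ⟨e, he⟩ := hglue x fun μ ν => sub_eq_zero.1 (congrFun hx (μ, ν))
      exact ⟨e, funext he⟩
    · rintro ⟨e, rfl⟩
      ext p
      simp [d, hc]
  have hex2 := Module.Flat.rTensor_exact M hex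
  let X : (∀ l, Q l) ⊗[k] M := ∑ l, (LinearMap.single k Q l).rTensor M (F l)
  have hX : ∀ l, (LinearMap.proj l : (∀ l, Q l) →ₗ[k] Q l).rTensor M X = F l := by
    intro l
    simp only [X, map_sum]
    rw [Finset.sum_eq_single l]
    · rw [← LinearMap.comp_apply, ← LinearMap.rTensor_comp, LinearMap.proj_comp_single_same]; simp
    · intro b _ hb
      rw [← LinearMap.comp_apply, ← LinearMap.rTensor_comp, LinearMap.proj_comp_single_ne]
      · simp
      · first | exact hb | exact hb.symm
    · simp
  have hdX : d.rTensor M X = 0 := by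
    apply pi_tensor_ext
    rintro ⟨μ, ν⟩
    rw [← LinearMap.comp_apply, ← LinearMap.rTensor_comp, LinearMap.proj_pi, LinearMap.rTensor_sub,
      LinearMap.sub_apply, LinearMap.rTensor_comp, LinearMap.rTensor_comp, LinearMap.comp_apply,
      LinearMap.comp_apply, hX, hX, sub_eq_zero]
    exact hF μ ν
  obtain ⟨H, hH⟩ := (hex2 X).1 hdX
  refine ⟨H, fun l => ?_⟩
  rw [← hX l, ← hH, ← LinearMap.comp_apply, ← LinearMap.rTensor_comp, LinearMap.proj_pi]
  rfl

end Tensor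

end Helpers

/-- **Theorem 3.** Let `B` be a Hopf algebra over a field `k`, `(E, ρ)` a right
`B`-comodule algebra, and `(M, ρM)` a left `B`-comodule.  Let `{T l}` be a finite cover
of `E` by `ρ`-compatible left Ore sets, with localized coactions `ρl l` on
`E_l = (T l)⁻¹E`, and for each `l` let `γ l : B → E_l` be a `B`-comodule algebra map;
let `κ_l : E_l^{co B} ⊗ M → E_l ⊗ M` be the associated trivialization map, and let
`E2 μ ν` (with maps `g μ ν`, the localization of `E_ν` at `T μ`, and `h2 μ ν`, the
localization of `i_ν` at `T μ`) be the consecutive localizations.  Then the assignment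
`H ↦ (κ_l⁻¹ ((i_l ⊗ id) H))_l` is a well-defined `k`-linear bijection from the cotensor
product `E □_B M` onto the space `Γξ_M` of glued families of local sections. -/
theorem global_sections_of_associated_bundle_eq_cotensor
    {k : Type u} [Field k] {B : Type u} [Ring B] [HopfAlgebra k B]
    {E : Type u} [Ring E] [Algebra k E]
    (ρ : E →ₐ[k] E ⊗[k] B) (hρ : IsComoduleAlgebra k B ρ)
    {M : Type u} [AddCommGroup M] [Module k M]
    (ρM : M →ₗ[k] B ⊗[k] M) (hM : IsLeftComodule k B ρM)
    {Λ : Type u} [Finite Λ]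
    (T : Λ → Set E) (hT : ∀ l, IsLeftOreSet (T l))
    (Q : Λ → Type u) [∀ l, Ring (Q l)] [∀ l, Algebra k (Q l)]
    (i : ∀ l, E →ₐ[k] Q l)
    (hloc : ∀ l, IsLeftOreRingLocalization (T l) (i l).toRingHom)
    (hcover : ∀ (N : Type u) [AddCommGroup N] [Module E N],
      (∀ l, ∀ x : N, ∃ t ∈ T l, t • x = 0) → ∀ x : N, x = 0)
    (ρl : ∀ l, Q l →ₐ[k] Q l ⊗[k] B) (hρl : ∀ l, IsComoduleAlgebra k B (ρl l))
    (hcompat : ∀ l, ∀ e : E,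
      ρl l (i l e) = Algebra.TensorProduct.map (i l) (AlgHom.id k B) (ρ e))
    (γ : ∀ l, B →ₐ[k] Q l)
    (hγ : ∀ l, ∀ b : B, ρl l (γ l b) =
      TensorProduct.map (γ l).toLinearMap LinearMap.id (Coalgebra.comul (R := k) (A := B) b))
    (E2 : Λ → Λ → Type u) [∀ μ ν, AddCommGroup (E2 μ ν)] [∀ μ ν, Module k (E2 μ ν)]
    [∀ μ ν, Module E (E2 μ ν)] [∀ μ ν, IsScalarTower k E (E2 μ ν)]
    (g : ∀ μ ν, Q ν →ₗ[k] E2 μ ν)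
    (hg_semilinear : ∀ μ ν, ∀ (e : E) (x : Q ν), g μ ν (i ν e * x) = e • g μ ν x)
    (hg_bij : ∀ μ ν, ∀ t ∈ T μ, Function.Bijective (fun z : E2 μ ν => t • z))
    (hg_surj : ∀ μ ν, ∀ z : E2 μ ν, ∃ t ∈ T μ, ∃ x : Q ν, t • z = g μ ν x)
    (hg_ker : ∀ μ ν, ∀ x : Q ν, g μ ν x = 0 ↔ ∃ t ∈ T μ, i ν t * x = 0)
    (h2 : ∀ μ ν, Q μ →ₗ[k] E2 μ ν)
    (hh2_semilinear : ∀ μ ν, ∀ (e : E) (x : Q μ), h2 μ ν (i μ e * x) = e • h2 μ ν x)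
    (hh2_compat : ∀ μ ν, ∀ e : E, h2 μ ν (i μ e) = g μ ν (i ν e)) :
    ∃ φ : cotensorSubmodule k ρ ρM →ₗ[k] (∀ l, (coinvariants k (ρl l)) ⊗[k] M),
      (∀ (H : cotensorSubmodule k ρ ρM) (l : Λ),
        kappaCoinv k (ρl l) ρM (γ l) (φ H l)
          = TensorProduct.map (i l).toLinearMap LinearMap.id (H : E ⊗[k] M)) ∧
      (∀ (H : cotensorSubmodule k ρ ρM) (μ ν : Λ),
        TensorProduct.map (h2 μ ν) LinearMap.id (kappaCoinv k (ρl μ) ρM (γ μ) (φ H μ))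
          = TensorProduct.map (g μ ν) LinearMap.id (kappaCoinv k (ρl ν) ρM (γ ν) (φ H ν))) ∧
      Function.Injective φ ∧
      (∀ F : ∀ l, (coinvariants k (ρl l)) ⊗[k] M,
        (∀ μ ν : Λ,
          TensorProduct.map (h2 μ ν) LinearMap.id (kappaCoinv k (ρl μ) ρM (γ μ) (F μ))
            = TensorProduct.map (g μ ν) LinearMap.id (kappaCoinv k (ρl ν) ρM (γ ν) (F ν))) →
        ∃ H : cotensorSubmodule k ρ ρM, φ H = F) := by
  classical
  letI : ∀ l, Module E (Q l) := fun l => Module.compHom (Q l) (i l).toRingHom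
  have hsm : ∀ l (e : E) (x : Q l), e • x = i l e * x := fun _ _ _ => rfl
  let iE : ∀ l, E →ₗ[E] Q l := fun l =>
    { toFun := i l, map_add' := map_add _, map_smul' := fun a b => by simp [hsm] }
  let gE : ∀ μ ν, Q ν →ₗ[E] E2 μ ν := fun μ ν =>
    { toFun := g μ ν, map_add' := map_add _, map_smul' := fun a b => hg_semilinear μ ν a b }
  let hE : ∀ μ ν, Q μ →ₗ[E] E2 μ ν := fun μ ν =>
    { toFun := h2 μ ν, map_add' := map_add _, map_smul' := fun a b => hh2_semilinear μ ν a b }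
  have hinj : ∀ e : E, (∀ l, (i l).toLinearMap e = 0) → e = 0 :=
    glue_inj T hcover Q iE (fun l r h => ((hloc l).ker r).1 h)
  have hglue : ∀ x : ∀ l, Q l, (∀ μ ν, h2 μ ν (x μ) = g μ ν (x ν)) →
      ∃ e, ∀ l, (i l).toLinearMap e = x l :=
    glue_surj T hT hcover Q iE (fun l x => (hloc l).surj x) E2 gE hE
      (fun μ ν x h => (hg_ker μ ν x).1 h) hh2_compat
  -- localization preserves the cotensor product
  have hassoc : ∀ l (x : E ⊗[k] M), TensorProduct.assoc k (Q l) B M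
      (TensorProduct.map (ρl l).toLinearMap LinearMap.id
        (TensorProduct.map (i l).toLinearMap LinearMap.id x)) =
      TensorProduct.map (i l).toLinearMap LinearMap.id (TensorProduct.assoc k E B M
        (TensorProduct.map ρ.toLinearMap LinearMap.id x)) := by
    intro l x
    induction x with
    | zero => simp
    | add x y hx hy => simp only [map_add, hx, hy]
    | tmul e m =>
      simp only [TensorProduct.map_tmul, AlgHom.toLinearMap_apply, hcompat, LinearMap.id_apply]
      induction ρ e with
      | zero => simp
      | add x y hx hy => simp only [map_add, TensorProduct.add_tmul, hx, hy]
      | tmul b n => simp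
  have hcoM : ∀ l (x : E ⊗[k] M), TensorProduct.map LinearMap.id ρM
        (TensorProduct.map (i l).toLinearMap LinearMap.id x) =
      TensorProduct.map (i l).toLinearMap LinearMap.id
        (TensorProduct.map LinearMap.id ρM x) := by
    intro l x
    induction x with
    | zero => simp
    | add x y hx hy => simp only [map_add, hx, hy]
    | tmul e m => simp
  have hmem : ∀ l (x : E ⊗[k] M), x ∈ cotensorSubmodule k ρ ρM →
      TensorProduct.map (i l).toLinearMap LinearMap.id x ∈ cotensorSubmodule k (ρl l) ρM := by
    intro l x hx
    rw [mem_cotensor] at hx ⊢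
    rw [hassoc, hcoM, hx]
  let P : ∀ l, Q l →ₗ[k] coinvariants k (ρl l) := fun l =>
    LinearMap.codRestrict _ (ract (ρl l) LinearMap.id
      (WithConv.toConv ((γ l).toLinearMap ∘ₗ HopfAlgebra.antipode k)))
      (ract_coinv (hρl l) (γ l) (hγ l))
  have hκP : ∀ l (x : Q l ⊗[k] M), x ∈ cotensorSubmodule k (ρl l) ρM →
      kappaCoinv k (ρl l) ρM (γ l) (TensorProduct.map (P l) LinearMap.id x) = x := by
    intro l x hx
    rw [kappaCoinv_eq, ← LinearMap.comp_apply (TensorProduct.map _ _), ← TensorProduct.map_comp,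
      LinearMap.subtype_comp_codRestrict, LinearMap.id_comp, ract_cotensor _ _ _ _ hx,
      lact_lact hM, conv_inv_left, lact_one hM]
  have hκinj : ∀ l, Function.Injective (kappaCoinv k (ρl l) ρM (γ l)) := by
    intro l x y hxy
    rw [kappaCoinv_eq, kappaCoinv_eq] at hxy
    have h3 := congrArg (lact ρM
      (WithConv.toConv ((γ l).toLinearMap ∘ₗ HopfAlgebra.antipode k))) hxy
    rw [lact_lact hM, lact_lact hM, conv_inv_right, lact_one hM, lact_one hM] at h3
    exact Module.Flat.rTensor_preserves_injective_linearMap (M := M)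
      (coinvariants k (ρl l)).subtype (Submodule.injective_subtype _) h3
  let φ : cotensorSubmodule k ρ ρM →ₗ[k] (∀ l, (coinvariants k (ρl l)) ⊗[k] M) :=
    LinearMap.pi fun l => TensorProduct.map (P l) LinearMap.id ∘ₗ
      TensorProduct.map (i l).toLinearMap LinearMap.id ∘ₗ (cotensorSubmodule k ρ ρM).subtype
  have hφ : ∀ (H : cotensorSubmodule k ρ ρM) (l : Λ),
        kappaCoinv k (ρl l) ρM (γ l) (φ H l)
          = TensorProduct.map (i l).toLinearMap LinearMap.id (H : E ⊗[k] M) :=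
    fun H l => hκP l _ (hmem l _ H.2)
  refine ⟨φ, hφ, ?_, ?_, ?_⟩
  · intro H μ ν
    rw [hφ, hφ, ← LinearMap.comp_apply, ← LinearMap.comp_apply, ← TensorProduct.map_comp,
      ← TensorProduct.map_comp]
    congr 2
    ext e
    exact hh2_compat μ ν e
  · intro H H' h
    apply Subtype.ext
    apply tensor_inj Q (fun l => (i l).toLinearMap) hinj
    intro l
    rw [← hφ, ← hφ, h]
  · intro F hF
    obtain ⟨H, hH⟩ := tensor_glue Q (fun l => (i l).toLinearMap) E2 g h2 hh2_compat hglue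
      (fun l => kappaCoinv k (ρl l) ρM (γ l) (F l)) hF
    have hHm : H ∈ cotensorSubmodule k ρ ρM := by
      rw [mem_cotensor]
      apply tensor_inj Q (fun l => (i l).toLinearMap) hinj
      intro l
      rw [← hassoc, ← hcoM, ← mem_cotensor, hH]
      exact kappa_mem _ hM _ (hγ l) _
    refine ⟨⟨H, hHm⟩, funext fun l => hκinj l ?_⟩
    rw [hφ]
    exact hH l
end

section
/- Proposition 6: Let k be a field and F the free associative k-algebra on n² generators t^i_j (1 ≤ i, j ≤ n), with T = (t^i_j) the n×n matrix of generators. A square submatrix of T is a matrix T^I_J = (t^{i_a}_{j_b})_{a,b} for multi-indices I = (i_1,…,i_m), J = (j_1,…,j_m). For a set Σ of square submatrices of T, a ring homomorphism f : F → S is called Σ-inverting if the entrywise image under f of each member of Σ is an invertible matrix over S; a Σ-inverting homomorphism j : F → L is a Cohn localization of F at Σ if for every Σ-inverting homomorphism f : F → S there exists a unique ring homomorphism f̃ : L → S with f̃ ∘ j = f. Claim: if Σ₁ ⊆ Σ₂ are two sets of square submatrices of T, and j₁ : F → L₁ and j₂ : F → L₂ are Cohn localizations of F at Σ₁ and Σ₂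 respectively, then j₁, j₂, and the unique ring homomorphism φ : L₁ → L₂ satisfying φ ∘ j₁ = j₂ are all injective. -/
universe u

/-- The data of a square submatrix of the `n × n` matrix of generators: a size `m`
together with injective row and column multi-indices. -/
structure SquareSubmatrixIdx (n : ℕ) where
  m : ℕ
  I : Fin m → Fin n
  J : Fin m → Fin n
  hI : Function.Injective I
  hJ : Function.Injective J

/-- A ring homomorphism `f` from the free algebra on the `n × n` generators `t^i_j` is
`Σ`-inverting if the entrywise image under `f` of every submatrix in `Σ` is an
invertible matrix. -/
def IsInverting {k : Type u} [Field k] {n : ℕ} (Sigmas : Set (SquareSubmatrixIdx n))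
    {S : Type u} [Ring S] (f : FreeAlgebra k (Fin n × Fin n) →+* S) : Prop :=
  ∀ A ∈ Sigmas,
    IsUnit (Matrix.of fun a b : Fin A.m => f (FreeAlgebra.ι k (A.I a, A.J b)))

/-- `j : F → L` is a Cohn localization (universal `Σ`-inverting localization) of the free
algebra `F` at the set `Σ` of square submatrices of the matrix of generators: `j` is
`Σ`-inverting and every `Σ`-inverting ring map factors uniquely through `j`. -/
structure IsCohnLocalization {k : Type u} [Field k] {n : ℕ}
    (Sigmas : Set (SquareSubmatrixIdx n)) {L : Type u} [Ring L]
    (j : FreeAlgebra k (Fin n × Fin n) →+* L) : Prop where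
  inverting : IsInverting Sigmas j
  universal : ∀ (S : Type u) [Ring S] (f : FreeAlgebra k (Fin n × Fin n) →+* S),
    IsInverting Sigmas f → ∃! g : L →+* S, g.comp j = f

theorem freeL {k : Type u} [Field k] {X : Type} [Fintype X] [DecidableEq X] (c : k) (r : X → FreeAlgebra k X)
    (h : algebraMap k _ c + ∑ x, FreeAlgebra.ι k x * r x = 0) : c = 0 ∧ r = 0 := by
  let R := FreeAlgebra k X
  let ph : (k × (X → R)) →ₗ[k] R :=
    (Algebra.linearMap k R).coprod (∑ x, LinearMap.mulLeft k (FreeAlgebra.ι k x) ∘ₗ LinearMap.proj x)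
  have hph : ∀ p : k × (X → R), ph p = algebraMap k R p.1 + ∑ x, FreeAlgebra.ι k x * p.2 x := by
    intro p; simp [ph]
  let t : X → Module.End k (k × (X → R)) := fun x =>
    LinearMap.inr k k (X → R) ∘ₗ LinearMap.single k (fun _ => R) x ∘ₗ ph
  have ht : ∀ x p, t x p = (0, Pi.single x (ph p)) := fun x p => rfl
  let A := FreeAlgebra.lift k t
  have h1 : ∀ (a : R) p, ph (A a p) = a * ph p := by
    intro a
    induction a using FreeAlgebra.induction with
    | grade0 r => intro p; rw [AlgHom.commutes, Module.algebraMap_end_apply, map_smul, Algebra.smul_def]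
    | grade1 x =>
      intro p
      simp only [A, FreeAlgebra.lift_ι_apply, ht, hph (0, _)]
      simp [Pi.single_apply]
    | mul a b ha hb => intro p; rw [map_mul, Module.End.mul_apply, ha, hb, mul_assoc]
    | add a b ha hb => intro p; simp only [map_add, LinearMap.add_apply, ha, hb, add_mul]
  have h1' : ph (1, 0) = 1 := by simp [hph]
  have h2 : A (algebraMap k _ c + ∑ x, FreeAlgebra.ι k x * r x) (1, 0) = (c, r) := by
    simp only [map_add, map_sum, LinearMap.add_apply, LinearMap.sum_apply, map_mul, Module.End.mul_apply]
    have : ∀ x, A (FreeAlgebra.ι k x) (A (r x) (1, 0)) = ((0 : k), Pi.single x (r x)) := by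
      intro x
      have : A (FreeAlgebra.ι k x) = t x := FreeAlgebra.lift_ι_apply _ _
      rw [this, ht, h1, h1', mul_one]
    simp only [this]
    ext
    · simp [Prod.fst_sum]
    · simp [Prod.snd_sum, Finset.univ_sum_single]
  rw [h] at h2
  simp only [map_zero, LinearMap.zero_apply] at h2
  have := Prod.ext_iff.1 h2
  exact ⟨this.1.symm, this.2.symm⟩

structure FRep (k : Type u) [Field k] (n : ℕ) where
  V : Type u
  [acg : AddCommGroup V]
  [mod : Module k V]
  T : Fin n → Fin n → V →ₗ[k] V

attribute [instance] FRep.acg FRep.mod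

namespace FRep

variable {k : Type u} [Field k] {n : ℕ}

def Inj (M : FRep k n) : Prop :=
  ∀ I J : Finset (Fin n), I.card = J.card → ∀ w : Fin n → M.V,
    (∀ i ∈ I, ∑ j ∈ J, M.T i j (w j) = 0) → ∀ j ∈ J, w j = 0

def Surj (M : FRep k n) (I J : Finset (Fin n)) : Prop :=
  ∀ v : Fin n → M.V, ∃ w : Fin n → M.V, ∀ i ∈ I, ∑ j ∈ J, M.T i j (w j) = v i

def IsHom (M N : FRep k n) (f : M.V →ₗ[k] N.V) : Prop :=
  ∀ i j v, f (M.T i j v) = N.T i j (f v)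

theorem exists_compl (M : FRep k n) (I J : Finset (Fin n)) :
    ∃ (ι : Type u) (s : ι → Fin n → M.V),
      (∀ v : Fin n → M.V, ∃ (μ : ι →₀ k) (w : Fin n → M.V), ∀ i ∈ I,
        v i = Finsupp.linearCombination k (fun b => s b i) μ + ∑ j ∈ J, M.T i j (w j)) ∧
      (∀ (μ : ι →₀ k) (w : Fin n → M.V), (∀ i ∈ I,
        ∑ j ∈ J, M.T i j (w j) + Finsupp.linearCombination k (fun b => s b i) μ = 0) → μ = 0) := by
  classical
  let A : (Fin n → M.V) →ₗ[k] (I → M.V) :=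
    LinearMap.pi fun i => ∑ j ∈ J, M.T i j ∘ₗ LinearMap.proj j
  have hA : ∀ w i, A w i = ∑ j ∈ J, M.T i j (w j) := by
    intro w i; simp [A]
  let Q := (I → M.V) ⧸ LinearMap.range A
  let b := Module.Basis.ofVectorSpace k Q
  choose s hs using fun x => Submodule.mkQ_surjective (LinearMap.range A) (b x)
  have key : ∀ (μ : Module.Basis.ofVectorSpaceIndex k Q →₀ k) (i : I),
      Finsupp.linearCombination k (fun x => if h : i.1 ∈ I then s x ⟨i.1, h⟩ else 0) μ
        = Finsupp.linearCombination k s μ i := by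
    intro μ i
    simp [Finsupp.linearCombination_apply, Finsupp.sum]
  have hq : ∀ μ : Module.Basis.ofVectorSpaceIndex k Q →₀ k,
      (LinearMap.range A).mkQ (Finsupp.linearCombination k s μ) = Finsupp.linearCombination k b μ := by
    intro μ
    rw [Finsupp.apply_linearCombination]
    congr 1
    congr 1
    funext x
    exact hs x
  refine ⟨Module.Basis.ofVectorSpaceIndex k Q, fun x i => if h : i ∈ I then s x ⟨i, h⟩ else 0, ?_, ?_⟩
  · intro v
    let v' : I → M.V := fun i => v i
    have h1 : (LinearMap.range A).mkQ v'
        = (LinearMap.range A).mkQ (Finsupp.linearCombination k s (b.repr ((LinearMap.range A).mkQ v'))) := by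
      rw [hq, b.linearCombination_repr]
    have h2 := (Submodule.Quotient.eq _).1 h1
    obtain ⟨w, hw⟩ := h2
    refine ⟨b.repr ((LinearMap.range A).mkQ v'), w, ?_⟩
    intro i hi
    have := congrFun hw ⟨i, hi⟩
    rw [hA, Pi.sub_apply] at this
    rw [this, key _ ⟨i, hi⟩]
    simp [v']
  · intro μ w h
    have h1 : Finsupp.linearCombination k s μ = A (-w) := by
      funext i
      have := h i i.2
      rw [key μ i, ← hA] at this
      rw [map_neg, Pi.neg_apply]
      exact eq_neg_of_add_eq_zero_right this
    have h2 := hq μ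
    rw [h1] at h2
    have h3 : (LinearMap.range A).mkQ (A (-w)) = 0 := by
      rw [Submodule.mkQ_apply, Submodule.Quotient.mk_eq_zero]
      exact ⟨_, rfl⟩
    rw [h3] at h2
    exact (linearIndependent_iff.1 b.linearIndependent) μ h2.symm

/-- degree one part. -/
noncomputable def Pk (I J : Finset (Fin n)) (j0 : Fin n) (ι : Type u) (i j : Fin n) :
    (Fin n → ι →₀ k) →ₗ[k] (Fin n → Fin n → Fin n → ι →₀ k) where
  toFun c := fun i0 j1 j2 => if i0 = i then
      (if j1 = j ∧ ¬ (i ∈ I ∧ j = j0 ∧ j2 = j0) then c j2 else 0)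
        - (if i ∈ I ∧ j = j0 ∧ j1 = j2 ∧ j1 ∈ J ∧ j1 ≠ j0 then c j0 else 0) else 0
  map_add' c d := by
    funext i0 j1 j2
    simp only [Pi.add_apply]
    split_ifs <;> module
  map_smul' r c := by
    funext i0 j1 j2
    simp only [Pi.smul_apply, RingHom.id_apply]
    split_ifs <;> module

noncomputable def Ps (M : FRep k n) (I : Finset (Fin n)) (j0 : Fin n) {ι : Type u} (s : ι → Fin n → M.V) (i j : Fin n) :
    (Fin n → ι →₀ k) →ₗ[k] M.V :=
  if i ∈ I ∧ j = j0 then Finsupp.linearCombination k (fun b => s b i) ∘ₗ LinearMap.proj j0 else 0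

abbrev FA (k : Type u) [Field k] (n : ℕ) := FreeAlgebra k (Fin n × Fin n)

/-- base change of coefficients. -/
noncomputable def up (k : Type u) [Field k] (n : ℕ) (ι : Type u) :
    (Fin n → Fin n → Fin n → ι →₀ k) →ₗ[k] (Fin n → Fin n → Fin n → ι →₀ FA k n) :=
  LinearMap.pi fun a => LinearMap.pi fun b => LinearMap.pi fun c =>
    Finsupp.mapRange.linearMap (Algebra.linearMap k (FA k n)) ∘ₗ LinearMap.proj c ∘ₗ LinearMap.proj b
      ∘ₗ LinearMap.proj a

noncomputable def mulG (k : Type u) [Field k] (n : ℕ) (ι : Type u) (r : FA k n) :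
    (Fin n → Fin n → Fin n → ι →₀ FA k n) →ₗ[k] (Fin n → Fin n → Fin n → ι →₀ FA k n) :=
  LinearMap.pi fun a => LinearMap.pi fun b => LinearMap.pi fun c =>
    Finsupp.mapRange.linearMap (LinearMap.mulLeft k r) ∘ₗ LinearMap.proj c ∘ₗ LinearMap.proj b
      ∘ₗ LinearMap.proj a

theorem up_apply (ι : Type u) (q : Fin n → Fin n → Fin n → ι →₀ k) (a b c : Fin n) (x : ι) :
    up k n ι q a b c x = algebraMap k _ (q a b c x) := by
  simp [up]

theorem mulG_apply (ι : Type u) (r : FA k n) (q : Fin n → Fin n → Fin n → ι →₀ FA k n)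
    (a b c : Fin n) (x : ι) :
    mulG k n ι r q a b c x = r * (q a b c x) := by
  simp [mulG]

/-- The extension. -/
noncomputable def ext (M : FRep k n) (I J : Finset (Fin n)) (j0 : Fin n) {ι : Type u}
    (s : ι → Fin n → M.V) : FRep k n where
  V := M.V × (Fin n → Fin n → Fin n → ι →₀ FA k n) × (Fin n → ι →₀ k)
  T i j :=
    { toFun := fun p => (M.T i j p.1 + M.Ps I j0 s i j p.2.2,
        mulG k n ι (FreeAlgebra.ι k (i, j)) p.2.1 + up k n ι (Pk I J j0 ι i j p.2.2), 0)
      map_add' := by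
        intro p q
        simp only [Prod.fst_add, Prod.snd_add, map_add, Prod.mk_add_mk, add_zero]
        congr 1
        · abel
        · congr 1
          abel
      map_smul' := by
        intro r p
        simp only [Prod.smul_fst, Prod.smul_snd, map_smul, RingHom.id_apply, Prod.smul_mk, smul_add,
          smul_zero] }

def pr1 (M : FRep k n) (I J : Finset (Fin n)) (j0 : Fin n) {ι : Type u}
    (s : ι → Fin n → M.V) : (M.ext I J j0 s).V →ₗ[k] M.V where
  toFun p := p.1
  map_add' _ _ := rfl
  map_smul' _ _ := rfl

def pr2 (M : FRep k n) (I J : Finset (Fin n)) (j0 : Fin n) {ι : Type u}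
    (s : ι → Fin n → M.V) : (M.ext I J j0 s).V →ₗ[k] (Fin n → Fin n → Fin n → ι →₀ FA k n) where
  toFun p := p.2.1
  map_add' _ _ := rfl
  map_smul' _ _ := rfl

def pr3 (M : FRep k n) (I J : Finset (Fin n)) (j0 : Fin n) {ι : Type u}
    (s : ι → Fin n → M.V) : (M.ext I J j0 s).V →ₗ[k] (Fin n → ι →₀ k) where
  toFun p := p.2.2
  map_add' _ _ := rfl
  map_smul' _ _ := rfl

theorem free_inj (i : Fin n) (J : Finset (Fin n)) (c : k) (r : Fin n → FA k n)
    (h : ∑ j ∈ J, FreeAlgebra.ι k (i, j) * r j + algebraMap k _ c = 0) :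
    c = 0 ∧ ∀ j ∈ J, r j = 0 := by
  classical
  have := freeL (X := Fin n × Fin n) c (fun x => if x.1 = i ∧ x.2 ∈ J then r x.2 else 0) (by
    refine Eq.trans ?_ h
    rw [add_comm, Fintype.sum_prod_type, Finset.sum_eq_single i]
    · simp
    · intro b _ hb
      simp [hb]
    · simp)
  refine ⟨this.1, fun j hj => ?_⟩
  have := congrFun this.2 (i, j)
  simpa [hj] using this

theorem ext_inj (M : FRep k n) (hM : M.Inj) (I J : Finset (Fin n)) (hc : I.card = J.card) (j0 : Fin n)
    (hj0 : j0 ∈ J) {ι : Type u} (s : ι → Fin n → M.V)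
    (hs : ∀ (μ : ι →₀ k) (w : Fin n → M.V), (∀ i ∈ I,
        ∑ j ∈ J, M.T i j (w j) + Finsupp.linearCombination k (fun b => s b i) μ = 0) → μ = 0) :
    (M.ext I J j0 s).Inj := by
  classical
  intro I' J' hc' w hw
  -- components
  set v : Fin n → M.V := fun j => (w j).1 with hv
  set d := fun j => (w j).2.1 with hd
  set c : Fin n → Fin n → ι →₀ k := fun j => (w j).2.2 with hcc
  have e1 : ∀ i ∈ I', ∑ j ∈ J', M.T i j (v j) + ∑ j ∈ J', M.Ps I j0 s i j (c j) = 0 := by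
    intro i hi
    have := congrArg (pr1 M I J j0 s) (hw i hi)
    rw [map_sum, map_zero] at this
    rw [← Finset.sum_add_distrib]
    exact this
  have e2 : ∀ i ∈ I', ∀ a b e x, ∑ j ∈ J', FreeAlgebra.ι k (i, j) * (d j a b e x)
      + algebraMap k _ (∑ j ∈ J', Pk I J j0 ι i j (c j) a b e x) = 0 := by
    intro i hi a b e x
    have h1 := congrArg (pr2 M I J j0 s) (hw i hi)
    rw [map_sum, map_zero] at h1
    replace h1 := congrArg (fun p => p a b e x) h1
    simp only [Finset.sum_apply, Finsupp.finsetSum_apply] at h1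
    rw [map_sum, ← Finset.sum_add_distrib]
    refine Eq.trans (Finset.sum_congr rfl fun j _ => ?_) h1
    show _ = (mulG k n ι (FreeAlgebra.ι k (i, j)) (d j) + up k n ι (Pk I J j0 ι i j (c j))) a b e x
    rw [Pi.add_apply, Pi.add_apply, Pi.add_apply, Finsupp.add_apply, mulG_apply, up_apply]
  intro j1 hj1
  have hI' : I'.Nonempty := by
    rw [← Finset.card_pos, hc', Finset.card_pos]; exact ⟨j1, hj1⟩
  have hd0 : ∀ j ∈ J', d j = 0 := by
    intro j hj
    obtain ⟨i, hi⟩ := hI'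
    funext a b e
    ext x : 1
    exact (free_inj i J' _ _ (e2 i hi a b e x)).2 j hj
  have e3 : ∀ i ∈ I', ∀ j1 j2 x,
      (if j1 ∈ J' ∧ ¬ (i ∈ I ∧ j1 = j0 ∧ j2 = j0) then c j1 j2 x else 0)
       - (if j0 ∈ J' ∧ i ∈ I ∧ j1 = j2 ∧ j1 ∈ J ∧ j1 ≠ j0 then c j0 j0 x else 0) = 0 := by
    intro i hi j1 j2 x
    have := (free_inj i J' _ _ (e2 i hi i j1 j2 x)).1
    refine Eq.trans ?_ this
    have hP : ∀ j ∈ J', Pk I J j0 ι i j (c j) i j1 j2 x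
        = (if j = j1 then (if ¬ (i ∈ I ∧ j1 = j0 ∧ j2 = j0) then c j1 j2 x else 0) else 0)
        - (if j = j0 then (if i ∈ I ∧ j1 = j2 ∧ j1 ∈ J ∧ j1 ≠ j0 then c j0 j0 x else 0) else 0) := by
      intro j _
      simp only [Pk, LinearMap.coe_mk, AddHom.coe_mk, if_true, Finsupp.sub_apply]
      congr 1
      · by_cases h : j = j1
        · subst h
          by_cases h2 : (i ∈ I ∧ j = j0 ∧ j2 = j0)
          · rw [if_neg (fun h => h.2 h2), if_pos rfl, if_neg (fun h => h h2)]; rfl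
          · rw [if_pos ⟨rfl, h2⟩, if_pos rfl, if_pos h2]
        · rw [if_neg (fun h2 => h h2.1.symm), if_neg h]; rfl
      · by_cases h : j = j0
        · subst h
          by_cases h2 : (i ∈ I ∧ j1 = j2 ∧ j1 ∈ J ∧ j1 ≠ j)
          · rw [if_pos ⟨h2.1, rfl, h2.2⟩, if_pos rfl, if_pos h2]
          · rw [if_neg (fun h => h2 ⟨h.1, h.2.2⟩), if_pos rfl, if_neg h2]; rfl
        · rw [if_neg (fun h2 => h h2.2.1), if_neg h]; rfl
    rw [Finset.sum_congr rfl hP, Finset.sum_sub_distrib, Finset.sum_ite_eq', Finset.sum_ite_eq']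
    simp only [ite_and]
  have hc0 : ∀ j ∈ J', c j = 0 := by
    by_cases hcase : I' ⊆ I ∧ J ⊆ J'
    · obtain ⟨h1, h2⟩ := hcase
      have hJ : J = J' := Finset.eq_of_subset_of_card_le h2 (by
        rw [← hc', ← hc]; exact Finset.card_le_card h1)
      have hI : I' = I := Finset.eq_of_subset_of_card_le h1 (by rw [hc, hJ, hc'])
      subst hJ hI
      have hmu : c j0 j0 = 0 := by
        apply hs _ v
        intro i hi
        rw [← e1 i hi]
        congr 1
        rw [Finset.sum_eq_single j0]
        · simp [Ps, hi]
        · intro b _ hb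
          simp [Ps, hb]
        · intro h; exact absurd hj0 h
      obtain ⟨i, hi⟩ := hI'
      intro j hj
      funext j2
      ext x
      have := e3 i hi j j2 x
      rw [hmu] at this
      by_cases h : j = j0 ∧ j2 = j0
      · rw [h.1, h.2, hmu]; rfl
      · simpa [hj, hi, h] using this
    · have hmu : j0 ∈ J' → c j0 j0 = 0 := by
        intro hj0'
        ext x
        by_cases h1 : I' ⊆ I
        · have : ¬ J ⊆ J' := fun h => hcase ⟨h1, h⟩
          obtain ⟨j, hj, hj'⟩ := Finset.not_subset.1 this
          obtain ⟨i, hi⟩ := hI'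
          have := e3 i hi j j x
          have hne : j ≠ j0 := fun h => hj' (h ▸ hj0')
          simpa [hj, hj', hne, h1 hi, hj0'] using this
        · obtain ⟨i, hi, hi'⟩ := Finset.not_subset.1 h1
          have := e3 i hi j0 j0 x
          simpa [hi', hj0'] using this
      obtain ⟨i, hi⟩ := hI'
      intro j hj
      funext j2
      ext x
      have := e3 i hi j j2 x
      by_cases h : j = j0 ∧ j2 = j0
      · rw [h.1, h.2, hmu (h.1 ▸ hj)]; rfl
      · have h' : ¬ (i ∈ I ∧ j = j0 ∧ j2 = j0) := fun h2 => h h2.2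
        rw [if_pos ⟨hj, h'⟩] at this
        by_cases hj0' : j0 ∈ J'
        · simpa [hmu hj0'] using this
        · simpa [hj0'] using this
  have hv0 : ∀ j ∈ J', v j = 0 := by
    apply hM I' J' hc'
    intro i hi
    have := e1 i hi
    rwa [Finset.sum_eq_zero (s := J') (f := fun j => M.Ps I j0 s i j (c j)), add_zero] at this
    intro j hj
    rw [hc0 j hj, map_zero]
  exact Prod.ext (hv0 _ hj1) (Prod.ext (hd0 _ hj1) (hc0 _ hj1))


noncomputable def act (N : FRep k n) : FA k n →ₐ[k] Module.End k N.V :=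
  FreeAlgebra.lift k (fun x : Fin n × Fin n => (N.T x.1 x.2 : Module.End k N.V))

theorem act_ι (N : FRep k n) (i j : Fin n) : N.act (FreeAlgebra.ι k (i, j)) = N.T i j :=
  FreeAlgebra.lift_ι_apply _ _

noncomputable def Zl (N : FRep k n) {ι : Type u} (z : ι → Fin n → N.V) (e : Fin n) :
    (ι →₀ k) →ₗ[k] N.V := Finsupp.linearCombination k (fun x => z x e)

noncomputable def hG (N : FRep k n) {ι : Type u} (z : ι → Fin n → N.V) :
    (Fin n → Fin n → Fin n → ι →₀ FA k n) →ₗ[k] N.V :=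
  ∑ a, ∑ b, ∑ e, (Finsupp.lsum k (fun x => (LinearMap.applyₗ (N.T a b (z x e))) ∘ₗ
    N.act.toLinearMap)) ∘ₗ LinearMap.proj e ∘ₗ LinearMap.proj b ∘ₗ LinearMap.proj a

theorem hG_apply (N : FRep k n) {ι : Type u} (z : ι → Fin n → N.V)
    (d : Fin n → Fin n → Fin n → ι →₀ FA k n) :
    N.hG z d = ∑ a, ∑ b, ∑ e, (d a b e).sum fun x r => N.act r (N.T a b (z x e)) := by
  simp [hG, LinearMap.sum_apply, Function.comp_def]

theorem hG_mul (N : FRep k n) {ι : Type u} (z : ι → Fin n → N.V)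
    (d : Fin n → Fin n → Fin n → ι →₀ FA k n) (i j : Fin n) :
    N.hG z (mulG k n ι (FreeAlgebra.ι k (i, j)) d) = N.T i j (N.hG z d) := by
  simp only [hG_apply, map_sum]
  refine Finset.sum_congr rfl fun a _ => Finset.sum_congr rfl fun b _ =>
    Finset.sum_congr rfl fun e _ => ?_
  have : mulG k n ι (FreeAlgebra.ι k (i, j)) d a b e
    = Finsupp.mapRange (fun r => FreeAlgebra.ι k (i, j) * r) (mul_zero _) (d a b e) := by
    ext x; simp [mulG_apply]
  rw [this, Finsupp.sum_mapRange_index (by intro x; simp), map_finsuppSum]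
  refine Finsupp.sum_congr fun x _ => ?_
  rw [map_mul, Module.End.mul_apply, act_ι]

theorem hG_up (N : FRep k n) {ι : Type u} (z : ι → Fin n → N.V)
    (q : Fin n → Fin n → Fin n → ι →₀ k) :
    N.hG z (up k n ι q) = ∑ a, ∑ b, ∑ e, N.T a b (N.Zl z e (q a b e)) := by
  simp only [hG_apply]
  refine Finset.sum_congr rfl fun a _ => Finset.sum_congr rfl fun b _ =>
    Finset.sum_congr rfl fun e _ => ?_
  have : up k n ι q a b e
    = Finsupp.mapRange (algebraMap k (FA k n)) (map_zero _) (q a b e) := by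
    ext x; simp [up_apply]
  rw [this, Finsupp.sum_mapRange_index (by intro x; simp), Zl, Finsupp.linearCombination_apply, map_finsuppSum]
  refine Finsupp.sum_congr fun x _ => ?_
  rw [AlgHom.commutes, Module.algebraMap_end_apply, map_smul]

theorem Pk_calc (N : FRep k n) {ι : Type u} (z : ι → Fin n → N.V) (I J : Finset (Fin n))
    (j0 : Fin n) (hj0 : j0 ∈ J) (i j : Fin n) (c : Fin n → ι →₀ k) :
    N.hG z (up k n ι (Pk I J j0 ι i j c)) +
      (if i ∈ I ∧ j = j0 then ∑ j ∈ J, N.T i j (N.Zl z j (c j0)) else 0)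
      = N.T i j (∑ e, N.Zl z e (c e)) := by
  classical
  rw [hG_up, Finset.sum_eq_single i]
  · by_cases h : i ∈ I ∧ j = j0
    · obtain ⟨h1, rfl⟩ := h
      have e1 : ∀ b e, N.T i b (N.Zl z e (Pk I J j ι i j c i b e)) =
         (if b = j then (if e = j then 0 else N.T i j (N.Zl z e (c e))) else 0) -
         (if b = e then (if e ∈ J.erase j then N.T i e (N.Zl z e (c j)) else 0) else 0) := by
        intro b e
        simp only [Pk, LinearMap.coe_mk, AddHom.coe_mk, if_true, map_sub]
        congr 1
        · by_cases hb : b = j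
          · by_cases he : e = j
            · simp [hb, he, h1]
            · simp [hb, he]
          · simp [hb]
        · by_cases hb : b = e
          · by_cases he : e = j
            · simp [hb, he, h1]
            · by_cases hJ : e ∈ J
              · simp [hb, he, hJ, h1]
              · simp [hb, he, hJ]
          · simp [hb]
      simp only [e1, Finset.sum_sub_distrib]
      rw [if_pos ⟨h1, trivial⟩]
      have e2 : ∑ b, ∑ e, (if b = j then (if e = j then 0 else N.T i j (N.Zl z e (c e))) else 0)
          = ∑ e, (if e = j then 0 else N.T i j (N.Zl z e (c e))) := by
        rw [Finset.sum_comm]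
        simp
      have e3 : ∑ b, ∑ e, (if b = e then (if e ∈ J.erase j then N.T i e (N.Zl z e (c j)) else 0) else 0)
          = ∑ e ∈ J.erase j, N.T i e (N.Zl z e (c j)) := by
        rw [Finset.sum_comm]
        simp only [Finset.sum_ite_eq', Finset.mem_univ, if_true]
        rw [← Finset.sum_filter]
        congr 1
        ext; simp
      have e4 : N.T i j (∑ e, N.Zl z e (c e)) = ∑ e, (if e = j then 0 else N.T i j (N.Zl z e (c e)))
          + N.T i j (N.Zl z j (c j)) := by
        rw [map_sum, ← Finset.add_sum_erase _ _ (Finset.mem_univ j),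
          ← Finset.add_sum_erase Finset.univ _ (Finset.mem_univ j)]
        rw [if_pos rfl, zero_add, add_comm]
        congr 1
        refine Finset.sum_congr rfl fun e he => ?_
        rw [if_neg (Finset.ne_of_mem_erase he)]
      rw [e2, e3, e4, ← Finset.add_sum_erase J _ hj0]
      abel
    · rw [if_neg h, add_zero, map_sum, Finset.sum_comm]
      refine Finset.sum_congr rfl fun e _ => ?_
      rw [Finset.sum_eq_single j]
      · simp only [Pk, LinearMap.coe_mk, AddHom.coe_mk, if_true]
        rw [if_pos ⟨trivial, fun h' => h ⟨h'.1, h'.2.1⟩⟩, if_neg (fun h' => h ⟨h'.1, h'.2.1⟩), sub_zero]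
      · intro b _ hb
        simp only [Pk, LinearMap.coe_mk, AddHom.coe_mk, if_true]
        rw [if_neg (fun h' => hb h'.1), if_neg (fun h' => h ⟨h'.1, h'.2.1⟩), sub_zero, map_zero, map_zero]
      · simp
  · intro a _ ha
    refine Finset.sum_eq_zero fun b _ => Finset.sum_eq_zero fun e _ => ?_
    simp [Pk, ha]
  · simp

def incl (M : FRep k n) (I J : Finset (Fin n)) (j0 : Fin n) {ι : Type u}
    (s : ι → Fin n → M.V) : M.V →ₗ[k] (M.ext I J j0 s).V where
  toFun p := (p, 0, 0)
  map_add' a b := by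
    show _ = ((a + b, 0 + 0, 0 + 0) : M.V × (Fin n → Fin n → Fin n → ι →₀ FA k n) × (Fin n → ι →₀ k))
    rw [add_zero, add_zero]
  map_smul' r b := by
    show _ = ((r • b, r • 0, r • 0) : M.V × (Fin n → Fin n → Fin n → ι →₀ FA k n) × (Fin n → ι →₀ k))
    rw [smul_zero, smul_zero]

/-- the new generators -/
noncomputable def gen (M : FRep k n) (I J : Finset (Fin n)) (j0 : Fin n) {ι : Type u}
    (s : ι → Fin n → M.V) (b : ι) (j : Fin n) : (M.ext I J j0 s).V :=
  ((0, 0, Pi.single j (Finsupp.single b 1)) :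
    M.V × (Fin n → Fin n → Fin n → ι →₀ FA k n) × (Fin n → ι →₀ k))

theorem ext_T (M : FRep k n) (I J : Finset (Fin n)) (j0 : Fin n) {ι : Type u}
    (s : ι → Fin n → M.V) (i j : Fin n) (p : (M.ext I J j0 s).V) :
    (M.ext I J j0 s).T i j p = ((M.T i j p.1 + M.Ps I j0 s i j p.2.2,
        mulG k n ι (FreeAlgebra.ι k (i, j)) p.2.1 + up k n ι (Pk I J j0 ι i j p.2.2), 0) :
    M.V × (Fin n → Fin n → Fin n → ι →₀ FA k n) × (Fin n → ι →₀ k)) := rfl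

theorem step (M : FRep k n) (hM : M.Inj) (I J : Finset (Fin n)) (hc : I.card = J.card) :
    ∃ (M' : FRep k n) (f : M.V →ₗ[k] M'.V), M'.Inj ∧ M.IsHom M' f ∧ Function.Injective f ∧
      (∀ v : Fin n → M.V, ∃ w : Fin n → M'.V, ∀ i ∈ I, ∑ j ∈ J, M'.T i j (w j) = f (v i)) ∧
      (∀ N : FRep k n, N.Surj I J → ∀ g : M.V →ₗ[k] N.V, M.IsHom N g →
        ∃ g' : M'.V →ₗ[k] N.V, M'.IsHom N g' ∧ ∀ v, g' (f v) = g v) := by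
  classical
  rcases J.eq_empty_or_nonempty with hJ | ⟨j0, hj0⟩
  · have hI : I = ∅ := by rw [← Finset.card_eq_zero, hc, hJ]; rfl
    subst hI
    exact ⟨M, LinearMap.id, hM, fun _ _ _ => rfl, fun _ _ h => h, fun v => ⟨0, by simp⟩,
      fun N _ g hg => ⟨g, hg, fun _ => rfl⟩⟩
  obtain ⟨ι, s, hs1, hs2⟩ := M.exists_compl I J
  have hhom : M.IsHom (M.ext I J j0 s) (M.incl I J j0 s) := by
    intro i j v
    rw [ext_T]
    show (M.T i j v, 0, 0) = ((M.T i j v + M.Ps I j0 s i j 0,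
      mulG k n ι (FreeAlgebra.ι k (i, j)) 0 + up k n ι (Pk I J j0 ι i j 0), 0) :
      M.V × (Fin n → Fin n → Fin n → ι →₀ FA k n) × (Fin n → ι →₀ k))
    simp only [map_zero, add_zero]
  refine ⟨M.ext I J j0 s, M.incl I J j0 s, M.ext_inj hM I J hc j0 hj0 s hs2, hhom, ?_, ?_, ?_⟩
  · intro a b h
    exact congrArg Prod.fst h
  · have hgen : ∀ b, ∀ i ∈ I, ∑ j ∈ J, (M.ext I J j0 s).T i j (M.gen I J j0 s b j)
        = M.incl I J j0 s (s b i) := by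
      intro b i hi
      have h1 : M.pr1 I J j0 s (∑ j ∈ J, (M.ext I J j0 s).T i j (M.gen I J j0 s b j)) = s b i := by
        rw [map_sum]
        have : ∀ j ∈ J, M.pr1 I J j0 s ((M.ext I J j0 s).T i j (M.gen I J j0 s b j)) =
            if j = j0 then s b i else 0 := by
          intro j _
          show M.T i j 0 + M.Ps I j0 s i j (Pi.single j (Finsupp.single b 1)) = _
          rw [map_zero, zero_add, Ps]
          by_cases h : j = j0
          · subst h
            simp [hi]
          · simp [h]
        rw [Finset.sum_congr rfl this]
        simp [hj0]
      have h2 : M.pr2 I J j0 s (∑ j ∈ J, (M.ext I J j0 s).T i j (M.gen I J j0 s b j)) = 0 := by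
        rw [map_sum]
        have : ∀ j ∈ J, M.pr2 I J j0 s ((M.ext I J j0 s).T i j (M.gen I J j0 s b j)) =
            up k n ι (Pk I J j0 ι i j (Pi.single j (Finsupp.single b 1))) := by
          intro j _
          show mulG k n ι (FreeAlgebra.ι k (i, j)) 0 +
            up k n ι (Pk I J j0 ι i j (Pi.single j (Finsupp.single b 1))) = _
          rw [map_zero, zero_add]
        rw [Finset.sum_congr rfl this, ← map_sum]
        convert map_zero (up k n ι)
        funext a j1 e
        simp only [Finset.sum_apply, Pi.zero_apply]
        by_cases ha : a = i
        · have : ∀ j ∈ J, Pk I J j0 ι i j (Pi.single j (Finsupp.single b (1 : k))) a j1 e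
              = (if j = j1 then (if j1 = e ∧ e ≠ j0 then Finsupp.single b 1 else 0) else 0)
              - (if j = j0 then (if j1 = e ∧ e ∈ J ∧ e ≠ j0 then Finsupp.single b 1 else 0) else 0) := by
            intro j _
            simp only [Pk, LinearMap.coe_mk, AddHom.coe_mk, if_pos ha]
            congr 1
            · by_cases h : j = j1
              · subst h
                by_cases h3 : j = e
                · subst h3
                  by_cases h4 : j = j0 <;> simp [h4, hi]
                · simp [h3, Ne.symm h3]
              · rw [if_neg (fun h' => h h'.1.symm), if_neg h]
            · by_cases h : j = j0
              · subst h
                by_cases h3 : j1 = e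
                · subst h3
                  simp [hi]
                · simp [h3]
              · simp [h]
          rw [Finset.sum_congr rfl this, Finset.sum_sub_distrib, Finset.sum_ite_eq', Finset.sum_ite_eq',
            if_pos hj0]
          by_cases h3 : j1 = e
          · subst h3
            by_cases h4 : j1 ∈ J <;> simp [h4]
          · simp [h3]
        · refine Finset.sum_eq_zero fun j _ => ?_
          simp [Pk, ha]
      have h3 : M.pr3 I J j0 s (∑ j ∈ J, (M.ext I J j0 s).T i j (M.gen I J j0 s b j)) = 0 := by
        rw [map_sum]
        exact Finset.sum_eq_zero fun j _ => rfl
      exact Prod.ext h1 (Prod.ext h2 h3)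
    intro v
    obtain ⟨μ, w, h⟩ := hs1 v
    refine ⟨fun j => M.incl I J j0 s (w j) + (Finsupp.linearCombination k (fun b => M.gen I J j0 s b j)) μ, ?_⟩
    intro i hi
    simp only [map_add, Finset.sum_add_distrib]
    rw [h i hi, map_add, add_comm]
    congr 1
    · simp only [Finsupp.linearCombination_apply, map_finsuppSum, map_smul]
      rw [← Finsupp.sum_finsetSum_comm]
      refine Finsupp.sum_congr fun b _ => ?_
      rw [← Finset.smul_sum, hgen b i hi]
    · simp only [map_sum, hhom i _ _]
  · intro N hN g hg
    choose z hz using fun b => hN (fun i => g (s b i))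
    refine ⟨g ∘ₗ M.pr1 I J j0 s + N.hG z ∘ₗ M.pr2 I J j0 s +
      (∑ e, N.Zl z e ∘ₗ LinearMap.proj e) ∘ₗ M.pr3 I J j0 s, ?_, ?_⟩
    · intro i j p
      have hps : g (M.Ps I j0 s i j p.2.2) =
          (if i ∈ I ∧ j = j0 then ∑ j ∈ J, N.T i j (N.Zl z j (p.2.2 j0)) else 0) := by
        unfold Ps
        by_cases h : i ∈ I ∧ j = j0
        · rw [if_pos h, if_pos h]
          simp only [LinearMap.comp_apply, Zl, Finsupp.linearCombination_apply, map_finsuppSum,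
            map_smul, LinearMap.proj_apply]
          rw [← Finsupp.sum_finsetSum_comm]
          refine Finsupp.sum_congr fun b _ => ?_
          rw [← Finset.smul_sum, hz b i h.1]
        · rw [if_neg h, if_neg h]; simp
      have e := Pk_calc N z I J j0 hj0 i j p.2.2
      have e1 : M.pr1 I J j0 s ((M.ext I J j0 s).T i j p) = M.T i j p.1 + M.Ps I j0 s i j p.2.2 := rfl
      have e2 : M.pr2 I J j0 s ((M.ext I J j0 s).T i j p) =
        mulG k n ι (FreeAlgebra.ι k (i, j)) p.2.1 + up k n ι (Pk I J j0 ι i j p.2.2) := rfl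
      have e3 : M.pr3 I J j0 s ((M.ext I J j0 s).T i j p) = 0 := rfl
      simp only [LinearMap.add_apply, LinearMap.comp_apply, e1, e2, e3, map_add, map_zero, add_zero]
      rw [hG_mul, hps, hg, LinearMap.sum_apply]
      simp only [LinearMap.comp_apply, LinearMap.proj_apply]
      show _ = N.T i j (g p.1) + N.T i j (N.hG z p.2.1) + N.T i j (∑ e, N.Zl z e (p.2.2 e))
      rw [← e]
      abel
    · intro v
      have e1 : M.pr1 I J j0 s (M.incl I J j0 s v) = v := rfl
      have e2 : M.pr2 I J j0 s (M.incl I J j0 s v) = 0 := rfl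
      have e3 : M.pr3 I J j0 s (M.incl I J j0 s v) = 0 := rfl
      simp only [LinearMap.add_apply, LinearMap.comp_apply, e1, e2, e3, map_zero, add_zero]


section lim

variable (X : ℕ → FRep k n) (stp : ∀ s, (X s).V →ₗ[k] (X (s + 1)).V)

def trn (a b : ℕ) (h : a ≤ b) : (X a).V →ₗ[k] (X b).V :=
  Nat.leRec (motive := fun b _ => (X a).V →ₗ[k] (X b).V) LinearMap.id (fun c _ g => stp c ∘ₗ g) h

theorem trn_self (a : ℕ) (x : (X a).V) : trn X stp a a le_rfl x = x := by
  simp [trn, Nat.leRec_self]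

theorem trn_succ (a b : ℕ) (h : a ≤ b) (x : (X a).V) :
    trn X stp a (b + 1) (Nat.le_succ_of_le h) x = stp b (trn X stp a b h x) := by
  simp [trn, Nat.leRec_succ _ _ h]

theorem trn_trn (a b c : ℕ) (h : a ≤ b) (h' : b ≤ c) (x : (X a).V) :
    trn X stp b c h' (trn X stp a b h x) = trn X stp a c (h.trans h') x := by
  induction c, h' using Nat.le_induction with
  | base => rw [trn_self]
  | succ c hc ih => rw [trn_succ X stp b c hc, ih, trn_succ X stp a c (h.trans hc)]

theorem trn_inj (hinj : ∀ s, Function.Injective (stp s)) (a b : ℕ) (h : a ≤ b) :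
    Function.Injective (trn X stp a b h) := by
  induction b, h using Nat.le_induction with
  | base => intro x y h; simpa [trn_self] using h
  | succ c hc ih =>
    intro x y h
    rw [trn_succ X stp a c hc, trn_succ X stp a c hc] at h
    exact ih (hinj _ h)

theorem trn_hom (hhom : ∀ s, (X s).IsHom (X (s + 1)) (stp s)) (a b : ℕ) (h : a ≤ b) :
    (X a).IsHom (X b) (trn X stp a b h) := by
  intro i j v
  induction b, h using Nat.le_induction with
  | base => rw [trn_self, trn_self]
  | succ c hc ih => rw [trn_succ X stp a c hc, ih, hhom, trn_succ X stp a c hc]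

instance trn_dir : DirectedSystem (fun s => (X s).V) (fun a b h => trn X stp a b h) where
  map_self a x := trn_self X stp a x
  map_map c b a h h' x := trn_trn X stp a b c h h' x

noncomputable def lim (hhom : ∀ s, (X s).IsHom (X (s + 1)) (stp s)) : FRep k n where
  V := Module.DirectLimit (fun s => (X s).V) (trn X stp)
  acg := inferInstance
  mod := inferInstance
  T i j := Module.DirectLimit.map (fun s => (X s).T i j) (by
    intro a b h
    ext x
    exact (trn_hom X stp hhom a b h i j x).symm)

noncomputable def toLim (hhom : ∀ s, (X s).IsHom (X (s + 1)) (stp s)) (s : ℕ) :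
    (X s).V →ₗ[k] (lim X stp hhom).V :=
  Module.DirectLimit.of k ℕ (fun s => (X s).V) (trn X stp) s

variable (hhom : ∀ s, (X s).IsHom (X (s + 1)) (stp s))

theorem toLim_hom (s : ℕ) : (X s).IsHom (lim X stp hhom) (toLim X stp hhom s) := by
  intro i j v
  have h : ∀ (a b : ℕ) (h : a ≤ b),
      (X b).T i j ∘ₗ trn X stp a b h = trn X stp a b h ∘ₗ (X a).T i j := by
    intro a b h
    ext x
    exact (trn_hom X stp hhom a b h i j x).symm
  exact (Module.DirectLimit.map_apply_of (f := trn X stp) (f' := trn X stp)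
    (fun s => (X s).T i j) h v).symm

theorem toLim_trn (a b : ℕ) (h : a ≤ b) (x : (X a).V) :
    toLim X stp hhom b (trn X stp a b h x) = toLim X stp hhom a x :=
  Module.DirectLimit.of_f

theorem toLim_inj (hinj : ∀ s, Function.Injective (stp s)) (s : ℕ) :
    Function.Injective (toLim X stp hhom s) := by
  rw [injective_iff_map_eq_zero]
  intro x hx
  obtain ⟨j, h, e⟩ := Module.DirectLimit.of.zero_exact hx
  exact (injective_iff_map_eq_zero _).1 (trn_inj X stp hinj s j h) _ e

theorem lim_fin (w : Fin n → (lim X stp hhom).V) :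
    ∃ (s : ℕ) (w' : Fin n → (X s).V), ∀ j, toLim X stp hhom s (w' j) = w j := by
  choose a x hx using fun j => Module.DirectLimit.exists_of (w j)
  refine ⟨Finset.univ.sup a, fun j => trn X stp (a j) _ (Finset.le_sup (Finset.mem_univ j)) (x j), ?_⟩
  intro j
  rw [toLim_trn]
  exact hx j

theorem lim_Inj (hinj : ∀ s, Function.Injective (stp s)) (hX : ∀ s, (X s).Inj) :
    (lim X stp hhom).Inj := by
  intro I J hc w hw j hj
  obtain ⟨s, w', h⟩ := lim_fin X stp hhom w
  have : w' j = 0 := by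
    refine hX s I J hc w' (fun i hi => ?_) j hj
    apply toLim_inj X stp hhom hinj s
    rw [map_zero, map_sum, ← hw i hi]
    refine Finset.sum_congr rfl fun j _ => ?_
    rw [toLim_hom X stp hhom s, h]
  rw [← h, this, map_zero]

end lim

theorem limit (M : FRep k n) (hM : M.Inj) (S : Set (Finset (Fin n) × Finset (Fin n)))
    (hS : ∀ p ∈ S, p.1.card = p.2.card) :
    ∃ (M' : FRep k n) (f : M.V →ₗ[k] M'.V), M'.Inj ∧ M.IsHom M' f ∧ Function.Injective f ∧
      (∀ p ∈ S, M'.Surj p.1 p.2) ∧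
      (∀ N : FRep k n, (∀ p ∈ S, N.Surj p.1 p.2) → ∀ g : M.V →ₗ[k] N.V, M.IsHom N g →
        ∃ g' : M'.V →ₗ[k] N.V, M'.IsHom N g' ∧ ∀ v, g' (f v) = g v) := by
  classical
  have st : ∀ (q : {M : FRep k n // M.Inj}) (p : Finset (Fin n) × Finset (Fin n)),
    ∃ (M' : FRep k n) (f : q.1.V →ₗ[k] M'.V), M'.Inj ∧ q.1.IsHom M' f ∧ Function.Injective f ∧
      (p ∈ S → ∀ v : Fin n → q.1.V, ∃ w : Fin n → M'.V, ∀ i ∈ p.1,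
        ∑ j ∈ p.2, M'.T i j (w j) = f (v i)) ∧
      (∀ N : FRep k n, (∀ p ∈ S, N.Surj p.1 p.2) → ∀ g : q.1.V →ₗ[k] N.V, q.1.IsHom N g →
        ∃ g' : M'.V →ₗ[k] N.V, M'.IsHom N g' ∧ ∀ v, g' (f v) = g v) := by
    intro q p
    by_cases hp : p ∈ S
    · obtain ⟨M', f, h1, h2, h3, h4, h5⟩ := q.1.step q.2 p.1 p.2 (hS p hp)
      exact ⟨M', f, h1, h2, h3, fun _ => h4, fun N hN => h5 N (hN p hp)⟩
    · exact ⟨q.1, LinearMap.id, q.2, fun _ _ _ => rfl, fun _ _ h => h, fun h => absurd h hp,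
        fun N _ g hg => ⟨g, hg, fun _ => rfl⟩⟩
  choose nx mp h1 h2 h3 h4 h5 using st
  obtain ⟨e0, he0⟩ := exists_surjective_nat (Finset (Fin n) × Finset (Fin n))
  let e : ℕ → Finset (Fin n) × Finset (Fin n) := fun s => e0 s.unpair.1
  have he : ∀ (p : Finset (Fin n) × Finset (Fin n)) (a : ℕ), ∃ b, a ≤ b ∧ e b = p := by
    intro p a
    obtain ⟨c, rfl⟩ := he0 p
    exact ⟨Nat.pair c a, Nat.right_le_pair c a, by simp [e]⟩
  let X : ℕ → {M : FRep k n // M.Inj} := fun s =>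
    Nat.rec ⟨M, hM⟩ (fun s q => ⟨nx q (e s), h1 q (e s)⟩) s
  let Y : ℕ → FRep k n := fun s => (X s).1
  let stp : ∀ s, (Y s).V →ₗ[k] (Y (s + 1)).V := fun s => mp (X s) (e s)
  have hhom : ∀ s, (Y s).IsHom (Y (s + 1)) (stp s) := fun s => h2 (X s) (e s)
  have hinj : ∀ s, Function.Injective (stp s) := fun s => h3 (X s) (e s)
  have hsol : ∀ s, e s ∈ S → ∀ v : Fin n → (Y s).V, ∃ w : Fin n → (Y (s + 1)).V, ∀ i ∈ (e s).1,
        ∑ j ∈ (e s).2, (Y (s + 1)).T i j (w j) = stp s (v i) := fun s => h4 (X s) (e s)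
  have hext : ∀ s, ∀ N : FRep k n, (∀ p ∈ S, N.Surj p.1 p.2) → ∀ g : (Y s).V →ₗ[k] N.V,
      (Y s).IsHom N g → ∃ g' : (Y (s + 1)).V →ₗ[k] N.V, (Y (s + 1)).IsHom N g' ∧
        ∀ v, g' (stp s v) = g v := fun s => h5 (X s) (e s)
  refine ⟨lim Y stp hhom, toLim Y stp hhom 0, lim_Inj Y stp hhom hinj (fun s => (X s).2),
    toLim_hom Y stp hhom 0, toLim_inj Y stp hhom hinj 0, ?_, ?_⟩
  · intro p hp v
    obtain ⟨a, v', hv'⟩ := lim_fin Y stp hhom v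
    obtain ⟨b, hab, rfl⟩ := he p a
    obtain ⟨w, hw⟩ := hsol b hp (fun j => trn Y stp a b hab (v' j))
    refine ⟨fun j => toLim Y stp hhom (b + 1) (w j), fun i hi => ?_⟩
    simp only [← toLim_hom Y stp hhom (b + 1) i, ← map_sum]
    rw [hw i hi, ← trn_succ, toLim_trn, hv']
  · intro N hN g hg
    let G : ∀ s, {g : (Y s).V →ₗ[k] N.V // (Y s).IsHom N g} := fun s =>
      Nat.rec ⟨g, hg⟩ (fun s q => ⟨(hext s N hN q.1 q.2).choose, (hext s N hN q.1 q.2).choose_spec.1⟩) s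
    have hG : ∀ s v, (G (s + 1)).1 (stp s v) = (G s).1 v := fun s =>
      (hext s N hN (G s).1 (G s).2).choose_spec.2
    have hG' : ∀ a b (h : a ≤ b) v, (G b).1 (trn Y stp a b h v) = (G a).1 v := by
      intro a b h v
      induction b, h using Nat.le_induction with
      | base => rw [trn_self]
      | succ c hc ih => rw [trn_succ Y stp a c hc, hG, ih]
    let g' : (lim Y stp hhom).V →ₗ[k] N.V :=
      Module.DirectLimit.lift k ℕ (fun s => (Y s).V) (trn Y stp) (fun s => (G s).1) hG'
    have hg' : ∀ s v, g' (toLim Y stp hhom s v) = (G s).1 v := fun s v =>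
      Module.DirectLimit.lift_of _ _ _
    refine ⟨g', ?_, fun v => hg' 0 v⟩
    intro i j v
    obtain ⟨s, v', rfl⟩ := Module.DirectLimit.exists_of v
    change g' ((lim Y stp hhom).T i j (toLim Y stp hhom s v')) = N.T i j (g' (toLim Y stp hhom s v'))
    rw [← toLim_hom Y stp hhom s, hg', hg', (G s).2]


def SP (S : Set (SquareSubmatrixIdx n)) : Set (Finset (Fin n) × Finset (Fin n)) :=
  {p | ∃ A ∈ S, p = (Finset.univ.image A.I, Finset.univ.image A.J)}

theorem SP_card (S : Set (SquareSubmatrixIdx n)) (p : Finset (Fin n) × Finset (Fin n))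
    (hp : p ∈ SP S) : p.1.card = p.2.card := by
  obtain ⟨A, _, rfl⟩ := hp
  simp [Finset.card_image_of_injective _ A.hI, Finset.card_image_of_injective _ A.hJ]

theorem inverting (M : FRep k n) (hM : M.Inj) (S : Set (SquareSubmatrixIdx n))
    (hS : ∀ p ∈ SP S, M.Surj p.1 p.2) : IsInverting S (M.act : FA k n →+* Module.End k M.V) := by
  classical
  intro A hA
  set B : Matrix (Fin A.m) (Fin A.m) (Module.End k M.V) :=
    Matrix.of fun a b : Fin A.m => M.act (FreeAlgebra.ι k (A.I a, A.J b)) with hB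
  change IsUnit B
  let E := endVecRingEquivMatrixEnd (Fin A.m) k M.V
  have hE : E (E.symm B) = B := E.apply_symm_apply B
  have happ : ∀ w a, E.symm B w a = ∑ b, M.T (A.I a) (A.J b) (w b) := by
    intro w a
    have : ∀ a b, B a b = M.T (A.I a) (A.J b) := fun a b => M.act_ι _ _
    simp only [← this]
    rfl
  have hsum : ∀ (w : Fin n → M.V) (a : Fin A.m),
      ∑ j ∈ Finset.univ.image A.J, M.T (A.I a) j (w j) = ∑ b, M.T (A.I a) (A.J b) (w (A.J b)) := by
    intro w a
    rw [Finset.sum_image (fun x _ y _ h => A.hJ h)]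
  have hcard := SP_card S _ ⟨A, hA, rfl⟩
  have : IsUnit (E.symm B) := by
    rw [Module.End.isUnit_iff]
    constructor
    · rw [injective_iff_map_eq_zero]
      intro w hw
      funext b
      have := hM _ _ hcard (Function.extend A.J w 0) (by
        intro i hi
        obtain ⟨a, _, rfl⟩ := Finset.mem_image.1 hi
        rw [hsum]
        simp only [A.hJ.extend_apply]
        rw [← happ, hw]; rfl) (A.J b) (Finset.mem_image_of_mem _ (Finset.mem_univ b))
      rwa [A.hJ.extend_apply] at this
    · intro v
      obtain ⟨w, hw⟩ := hS _ ⟨A, hA, rfl⟩ (Function.extend A.I v 0)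
      refine ⟨fun b => w (A.J b), ?_⟩
      funext a
      rw [happ, ← hsum, hw _ (Finset.mem_image_of_mem _ (Finset.mem_univ a)), A.hI.extend_apply]
  rw [← hE]
  exact this.map E

/-- the regular representation through a ring map -/
noncomputable def reg {L : Type u} [Ring L] (j : FA k n →+* L) : FRep k n :=
  letI : Module k L := Module.compHom L (j.comp (algebraMap k (FA k n)))
  { V := L
    T := fun a b =>
      { toFun := fun l => j (FreeAlgebra.ι k (a, b)) * l
        map_add' := mul_add _
        map_smul' := by
          intro r l
          change j (FreeAlgebra.ι k (a, b)) * (j (algebraMap k _ r) * l) =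
            j (algebraMap k _ r) * (j (FreeAlgebra.ι k (a, b)) * l)
          rw [← mul_assoc, ← mul_assoc, ← map_mul, ← map_mul, Algebra.commutes] } }

theorem reg_surj {L : Type u} [Ring L] (j : FA k n →+* L) (S : Set (SquareSubmatrixIdx n))
    (hj : IsInverting S j) : ∀ p ∈ SP S, (reg j).Surj p.1 p.2 := by
  classical
  rintro _ ⟨A, hA, rfl⟩ v
  obtain ⟨C, hC, -⟩ := isUnit_iff_exists.1 (hj A hA)
  let v' : Fin n → L := v
  let x : Fin A.m → L := fun b => ∑ a, C b a * v' (A.I a)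
  refine ⟨(Function.extend A.J x 0 : Fin n → L), ?_⟩
  intro i hi
  obtain ⟨a, _, rfl⟩ := Finset.mem_image.1 hi
  rw [Finset.sum_image (fun x _ y _ h => A.hJ h)]
  simp only [A.hJ.extend_apply]
  change ∑ b, j (FreeAlgebra.ι k (A.I a, A.J b)) * x b = v' (A.I a)
  simp only [x, Finset.mul_sum, ← mul_assoc]
  rw [Finset.sum_comm]
  simp only [← Finset.sum_mul]
  have : ∀ c, ∑ b, j (FreeAlgebra.ι k (A.I a, A.J b)) * C b c = if a = c then 1 else 0 := by
    intro c
    have := congrFun (congrFun hC a) c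
    rw [Matrix.mul_apply, Matrix.one_apply] at this
    exact this
  simp [this]

theorem reg_id_inj : (reg (RingHom.id (FA k n))).Inj := by
  intro I J hc w hw j hj
  have hI : I.Nonempty := by
    rw [← Finset.card_pos, hc, Finset.card_pos]; exact ⟨j, hj⟩
  obtain ⟨i, hi⟩ := hI
  let w' : Fin n → FA k n := w
  have h : ∑ j ∈ J, FreeAlgebra.ι k (i, j) * w' j = 0 := hw i hi
  exact (free_inj i J 0 w' (by rw [h, map_zero, add_zero])).2 j hj

theorem act_hom (M N : FRep k n) (f : M.V →ₗ[k] N.V) (hf : M.IsHom N f) (r : FA k n) :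
    ∀ m, f (M.act r m) = N.act r (f m) := by
  induction r using FreeAlgebra.induction with
  | grade0 r => intro p; simp only [AlgHom.commutes, Module.algebraMap_end_apply, map_smul]
  | grade1 x => intro p; exact (by rw [act_ι, act_ι, hf] : f (M.act (FreeAlgebra.ι k (x.1, x.2)) p) = N.act (FreeAlgebra.ι k (x.1, x.2)) (f p))
  | mul a b ha hb => intro p; simp only [map_mul, Module.End.mul_apply, ha, hb]
  | add a b ha hb => intro p; simp only [map_add, LinearMap.add_apply, ha, hb]

theorem act_reg {L : Type u} [Ring L] (j : FA k n →+* L) (r : FA k n) :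
    ∀ l : L, ((reg j).act r l : L) = j r * l := by
  induction r using FreeAlgebra.induction with
  | grade0 r => intro p; rw [AlgHom.commutes]; rfl
  | grade1 x => intro p; exact (by rw [act_ι]; rfl : ((reg j).act (FreeAlgebra.ι k (x.1, x.2)) p : L) = j (FreeAlgebra.ι k (x.1, x.2)) * p)
  | mul a b ha hb =>
    intro p
    rw [map_mul, map_mul, mul_assoc]
    exact (ha ((reg j).act b p)).trans (congrArg (fun y => j a * y) (hb p))
  | add a b ha hb =>
    intro p
    rw [map_add, map_add, add_mul]
    exact congrArg₂ (fun y z : L => y + z) (ha p) (hb p)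

theorem intertwine {S : Set (SquareSubmatrixIdx n)} {L : Type u} [Ring L] (j : FA k n →+* L)
    (h : IsCohnLocalization S j) {M N : Type u} [AddCommGroup M] [AddCommGroup N] [Module L M]
    [Module L N] (g : M →+ N) (hg : ∀ r m, g (j r • m) = j r • g m) (x : L) (m : M) :
    g (x • m) = x • g m := by
  classical
  let D : Subring L :=
    { carrier := {x | ∀ m, g (x • m) = x • g m}
      mul_mem' := by
        intro a b ha hb m
        rw [mul_smul, ha, hb, mul_smul]
      one_mem' := by intro m; simp
      add_mem' := by
        intro a b ha hb m
        rw [add_smul, map_add, ha, hb, add_smul]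
      zero_mem' := by intro m; simp
      neg_mem' := by
        intro a ha m
        rw [neg_smul, map_neg, ha, neg_smul] }
  let j' : FA k n →+* D := j.codRestrict D (fun r => hg r)
  have hinv : IsInverting S j' := by
    intro A hA
    obtain ⟨C, hC1, hC2⟩ := isUnit_iff_exists.1 (h.inverting A hA)
    set B : Matrix (Fin A.m) (Fin A.m) L :=
      Matrix.of fun a b : Fin A.m => j (FreeAlgebra.ι k (A.I a, A.J b)) with hB
    have hCD : ∀ a b, C a b ∈ D := by
      intro a b m
      have key : ∀ c, ∑ a, B c a • g (C a b • m) = ∑ a, B c a • (C a b • g m) := by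
        intro c
        have e1 : ∀ a, B c a • g (C a b • m) = g (B c a • C a b • m) := fun a => (hg _ _).symm
        simp only [e1, ← map_sum, smul_smul, ← Finset.sum_smul]
        have e2 : ∑ a, B c a * C a b = (1 : Matrix _ _ L) c b := by
          rw [← hC1, Matrix.mul_apply]
        rw [e2, Matrix.one_apply]
        split_ifs <;> simp
      have hrec : ∀ u : Fin A.m → N, ∀ a, u a = ∑ c, C a c • ∑ a', B c a' • u a' := by
        intro u a
        simp only [Finset.smul_sum, smul_smul]
        rw [Finset.sum_comm]
        simp only [← Finset.sum_smul]
        have e2 : ∀ a', ∑ c, C a c * B c a' = (1 : Matrix _ _ L) a a' := by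
          intro a'
          rw [← hC2, Matrix.mul_apply]
        simp [e2, Matrix.one_apply]
      rw [hrec (fun a => g (C a b • m)) a, hrec (fun a => C a b • g m) a]
      simp only [key]
    refine isUnit_iff_exists.2 ⟨Matrix.of fun a b => ⟨C a b, hCD a b⟩, ?_, ?_⟩
    · ext a b
      have := congrFun (congrFun hC1 a) b
      rw [Matrix.mul_apply] at this ⊢
      rw [AddSubmonoidClass.coe_finsetSum]
      refine this.trans ?_
      rw [Matrix.one_apply, Matrix.one_apply]
      split_ifs <;> rfl
    · ext a b
      have := congrFun (congrFun hC2 a) b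
      rw [Matrix.mul_apply] at this ⊢
      rw [AddSubmonoidClass.coe_finsetSum]
      refine this.trans ?_
      rw [Matrix.one_apply, Matrix.one_apply]
      split_ifs <;> rfl
  obtain ⟨f, hf, -⟩ := h.universal D j' hinv
  have h1 : (D.subtype.comp f).comp j = j := by
    rw [RingHom.comp_assoc, hf]; rfl
  have h2 : D.subtype.comp f = RingHom.id L :=
    (h.universal L j h.inverting).unique h1 (RingHom.id_comp j)
  have h3 : (f x : L) = x := RingHom.congr_fun h2 x
  have := (f x).2
  rw [h3] at this
  exact this m

end FRep

/-- **Proposition 6.** Let `F` be the free associative `k`-algebra on `n²` generators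
`t^i_j` and let `Sigma₁ ⊆ Sigma₂` be two sets of square submatrices of the matrix of generators
`T = (t^i_j)`.  If `j₁ : F → L₁` and `j₂ : F → L₂` are Cohn localizations of `F` at `Sigma₁`
and `Sigma₂` respectively, and `φ : L₁ → L₂` is the unique ring homomorphism with
`φ ∘ j₁ = j₂`, then `j₁`, `j₂` and `φ` are all injective. -/
theorem cohn_localizations_of_free_matrix_bialgebra_injective
    {k : Type u} [Field k] {n : ℕ}
    {Sigma₁ Sigma₂ : Set (SquareSubmatrixIdx n)} (hSigma : Sigma₁ ⊆ Sigma₂)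
    {L₁ : Type u} [Ring L₁] (j₁ : FreeAlgebra k (Fin n × Fin n) →+* L₁)
    (h₁ : IsCohnLocalization Sigma₁ j₁)
    {L₂ : Type u} [Ring L₂] (j₂ : FreeAlgebra k (Fin n × Fin n) →+* L₂)
    (h₂ : IsCohnLocalization Sigma₂ j₂)
    (φ : L₁ →+* L₂) (hφ : φ.comp j₁ = j₂) :
    Function.Injective j₁ ∧ Function.Injective j₂ ∧ Function.Injective φ := by
  let F0 : FRep k n := FRep.reg (RingHom.id (FRep.FA k n))
  obtain ⟨M₁, i₁, inj₁, hom₁, ii₁, s₁, x₁⟩ := F0.limit FRep.reg_id_inj (FRep.SP Sigma₁) (FRep.SP_card _)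
  obtain ⟨M₂, i₂, inj₂, hom₂, ii₂, s₂, -⟩ := M₁.limit inj₁ (FRep.SP Sigma₂) (FRep.SP_card _)
  have inv₁ := M₁.inverting inj₁ Sigma₁ s₁
  have inv₂ := M₂.inverting inj₂ Sigma₂ s₂
  obtain ⟨ρ₁, hρ₁, -⟩ := h₁.universal _ _ inv₁
  obtain ⟨ρ₂, hρ₂, -⟩ := h₂.universal _ _ inv₂
  have hρ₁' : ∀ r, ρ₁ (j₁ r) = M₁.act r := fun r => RingHom.congr_fun hρ₁ r
  have hρ₂' : ∀ r, ρ₂ (j₂ r) = M₂.act r := fun r => RingHom.congr_fun hρ₂ r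
  have hφ' : ∀ r, φ (j₁ r) = j₂ r := fun r => RingHom.congr_fun hφ r
  let one : F0.V := (1 : FRep.FA k n)
  have hone : ∀ r : FRep.FA k n, (F0.act r one : FRep.FA k n) = r := fun r =>
    (FRep.act_reg (RingHom.id (FRep.FA k n)) r 1).trans (mul_one r)
  have J2 : Function.Injective j₂ := by
    rw [injective_iff_map_eq_zero]
    intro r hr
    have e1 : i₂ (i₁ (F0.act r one)) = 0 := by
      rw [FRep.act_hom _ _ i₁ hom₁, FRep.act_hom _ _ i₂ hom₂, ← hρ₂', hr, map_zero]; rfl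
    rw [← map_zero i₂] at e1
    have e2 := ii₂ e1
    rw [← map_zero i₁] at e2
    exact (hone r).symm.trans (ii₁ e2)
  refine ⟨?_, J2, ?_⟩
  · intro a b hab
    apply J2
    rw [← hφ', ← hφ', hab]
  · rw [injective_iff_map_eq_zero]
    intro x hx
    let jl : F0.V →ₗ[k] (FRep.reg j₁).V :=
      { toFun := fun r => j₁ r
        map_add' := map_add j₁
        map_smul' := fun c r => map_mul j₁ (algebraMap k (FRep.FA k n) c) r }
    obtain ⟨g, hg, hgj⟩ := x₁ (FRep.reg j₁) (FRep.reg_surj j₁ Sigma₁ h₁.inverting) jl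
      (fun a b v => map_mul j₁ (FreeAlgebra.ι k (a, b)) v)
    letI m1 : Module L₁ M₁.V := Module.compHom M₁.V ρ₁
    letI m2 : Module L₁ M₂.V := Module.compHom M₂.V (ρ₂.comp φ)
    have t2 := FRep.intertwine j₁ h₁ (i₂ : M₁.V →+ M₂.V) (by
      intro r m
      change i₂ (ρ₁ (j₁ r) m) = ρ₂ (φ (j₁ r)) (i₂ m)
      rw [hρ₁', hφ', hρ₂', FRep.act_hom _ _ i₂ hom₂]) x (i₁ one)
    let ga : M₁.V →+ L₁ := (g : M₁.V →+ (FRep.reg j₁).V)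
    have t1 := FRep.intertwine j₁ h₁ ga (by
      intro r m
      change g (ρ₁ (j₁ r) m) = (j₁ r * (show L₁ from g m) : L₁)
      rw [hρ₁', FRep.act_hom _ _ g hg]
      exact FRep.act_reg j₁ r _) x (i₁ one)
    change i₂ (ρ₁ x (i₁ one)) = ρ₂ (φ x) (i₂ (i₁ one)) at t2
    rw [hx, map_zero, LinearMap.zero_apply, ← map_zero i₂] at t2
    have t3 : ρ₁ x (i₁ one) = 0 := ii₂ t2
    have t4 : ga (ρ₁ x (i₁ one)) = x * ga (i₁ one) := t1
    have t5 : ga (i₁ one) = 1 := (hgj one).trans (map_one j₁)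
    rw [t3, t5, map_zero, mul_one] at t4
    exact t4.symm
end

section
/- Quasideterminants and matrix inverses: Let R be a unital (possibly noncommutative) ring, n ≥ 2, and A = (a^i_j) ∈ M_n(R). Suppose that for every pair (i,j) the (n−1)×(n−1) submatrix A^{îĵ} obtained by deleting row i and column j is invertible over R, and that the quasideterminant |A|_{ij} := a^i_j − Σ_{k ≠ i, l ≠ j} a^i_l · ((A^{îĵ})⁻¹)_{lk} · a^k_j is invertible in R. Then A is invertible in M_n(R) and (A⁻¹)^i_j = (|A|_{ji})⁻¹ for all i, j. -/
/-- The `(i,j)`-th quasideterminant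
`|A|_{ij} = a^i_j − Σ_{k ≠ i, l ≠ j} a^i_l ((A^{îĵ})⁻¹)_{lk} a^k_j`, computed with a
given inverse `B` of the submatrix `A^{îĵ}` (rows `≠ i`, columns `≠ j`); here `B` is
indexed with rows labelled by the column labels `l ≠ j` and columns labelled by the row
labels `k ≠ i`. -/
noncomputable def quasidet {R : Type*} [Ring R] {n : ℕ}
    (A : Matrix (Fin n) (Fin n) R) (i j : Fin n)
    (B : Matrix {l : Fin n // l ≠ j} {k : Fin n // k ≠ i} R) : R :=
  A i j - ∑ l : {l : Fin n // l ≠ j}, ∑ k : {k : Fin n // k ≠ i},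
    A i (l : Fin n) * B l k * A (k : Fin n) j

theorem qd_col {R : Type*} [Ring R] {n : ℕ} (A : Matrix (Fin n) (Fin n) R) (i j : Fin n)
    (B : Matrix {l : Fin n // l ≠ j} {k : Fin n // k ≠ i} R)
    (hB : (A.submatrix (Subtype.val : {k : Fin n // k ≠ i} → Fin n)
          (Subtype.val : {l : Fin n // l ≠ j} → Fin n)) * B = 1) :
    ∃ v : Fin n → R, v j = 1 ∧ ∀ r, ∑ l, A r l * v l = if r = i then quasidet A i j B else 0 := by
  refine ⟨fun l => if h : l = j then 1 else - ∑ k : {k : Fin n // k ≠ i}, B ⟨l, h⟩ k * A k j,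
    by simp, fun r => ?_⟩
  rw [Fintype.sum_eq_add_sum_subtype_ne _ j]
  beta_reduce
  have e : ∀ l : {l : Fin n // l ≠ j}, A r l * (if h : (l : Fin n) = j then 1 else
      - ∑ k : {k : Fin n // k ≠ i}, B ⟨l, h⟩ k * A k j)
      = - ∑ k : {k : Fin n // k ≠ i}, A r l * B l k * A k j := by
    intro l
    rw [dif_neg l.2, mul_neg, Finset.mul_sum]
    simp only [mul_assoc]
  rw [Finset.sum_congr rfl (fun l _ => e l), Finset.sum_neg_distrib, dif_pos rfl, mul_one,
    ← sub_eq_add_neg]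
  split_ifs with hr
  · subst hr; rfl
  · rw [Finset.sum_comm, sub_eq_zero]
    have e2 : ∀ k : {k : Fin n // k ≠ i}, ∑ l : {l : Fin n // l ≠ j}, A r l * B l k
        = (1 : Matrix {k : Fin n // k ≠ i} {k : Fin n // k ≠ i} R) ⟨r, hr⟩ k := by
      intro k
      rw [← hB]; rfl
    simp only [← Finset.sum_mul, e2]
    simp [Matrix.one_apply]

theorem qd_row {R : Type*} [Ring R] {n : ℕ} (A : Matrix (Fin n) (Fin n) R) (i j : Fin n)
    (B : Matrix {l : Fin n // l ≠ j} {k : Fin n // k ≠ i} R)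
    (hB : B * (A.submatrix (Subtype.val : {k : Fin n // k ≠ i} → Fin n)
          (Subtype.val : {l : Fin n // l ≠ j} → Fin n)) = 1) :
    ∃ w : Fin n → R, ∀ c, ∑ k, w k * A k c = if c = j then quasidet A i j B else 0 := by
  refine ⟨fun k => if h : k = i then 1 else - ∑ l : {l : Fin n // l ≠ j}, A i l * B l ⟨k, h⟩,
    fun c => ?_⟩
  rw [Fintype.sum_eq_add_sum_subtype_ne _ i]
  beta_reduce
  have e : ∀ k : {k : Fin n // k ≠ i}, (if h : (k : Fin n) = i then 1 else
      - ∑ l : {l : Fin n // l ≠ j}, A i l * B l ⟨k, h⟩) * A k c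
      = - ∑ l : {l : Fin n // l ≠ j}, A i l * B l k * A k c := by
    intro k
    rw [dif_neg k.2, neg_mul, Finset.sum_mul]
  rw [Finset.sum_congr rfl (fun l _ => e l), Finset.sum_neg_distrib, dif_pos rfl, one_mul,
    ← sub_eq_add_neg, Finset.sum_comm]
  split_ifs with hr
  · subst hr; rfl
  · rw [sub_eq_zero]
    have e2 : ∀ l : {l : Fin n // l ≠ j}, ∑ k : {k : Fin n // k ≠ i}, B l k * A k c
        = (1 : Matrix {l : Fin n // l ≠ j} {l : Fin n // l ≠ j} R) l ⟨c, hr⟩ := by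
      intro k
      rw [← hB]; rfl
    simp only [mul_assoc, ← Finset.mul_sum, e2]
    simp [Matrix.one_apply]

/-- **Quasideterminants and matrix inverses.** Let `R` be a unital, possibly
noncommutative, ring, `n ≥ 2` and `A ∈ M_n(R)`.  Suppose that for every pair `(i,j)` the
`(n−1) × (n−1)` submatrix `A^{îĵ}` (delete row `i`, column `j`) is invertible, with
two-sided inverse `B i j`, and that every quasideterminant `|A|_{ij}` is invertible in
`R`.  Then `A` is invertible in `M_n(R)` and `(A⁻¹)^i_j = (|A|_{ji})⁻¹`. -/
theorem quasideterminants_give_inverse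
    {R : Type*} [Ring R] {n : ℕ} (hn : 2 ≤ n)
    (A : Matrix (Fin n) (Fin n) R)
    (B : ∀ i j : Fin n, Matrix {l : Fin n // l ≠ j} {k : Fin n // k ≠ i} R)
    (hB : ∀ i j : Fin n,
      (A.submatrix (Subtype.val : {k : Fin n // k ≠ i} → Fin n)
          (Subtype.val : {l : Fin n // l ≠ j} → Fin n)) * B i j = 1 ∧
      B i j * (A.submatrix (Subtype.val : {k : Fin n // k ≠ i} → Fin n)
          (Subtype.val : {l : Fin n // l ≠ j} → Fin n)) = 1)
    (hq : ∀ i j : Fin n, IsUnit (quasidet A i j (B i j))) :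
    IsUnit A ∧ ∀ i j : Fin n,
      Ring.inverse A i j = Ring.inverse (quasidet A j i (B j i)) := by
  choose v hv1 hv using fun i j => qd_col A i j (B i j) (hB i j).1
  choose w hw using fun i j => qd_row A i j (B i j) (hB i j).2
  let z : Fin n := ⟨0, by omega⟩
  let X : Matrix (Fin n) (Fin n) R :=
    Matrix.of fun l i => v i z l * Ring.inverse (quasidet A i z (B i z))
  let Y : Matrix (Fin n) (Fin n) R :=
    Matrix.of fun j k => Ring.inverse (quasidet A z j (B z j)) * w z j k
  have hX : A * X = 1 := by
    ext r i
    simp only [X, Matrix.mul_apply, Matrix.of_apply, ← mul_assoc, ← Finset.sum_mul, hv,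
      Matrix.one_apply]
    split_ifs
    · exact Ring.mul_inverse_cancel _ (hq i z)
    · simp
  have hY : Y * A = 1 := by
    ext j c
    simp only [Y, Matrix.mul_apply, Matrix.of_apply, mul_assoc, ← Finset.mul_sum, hw,
      Matrix.one_apply, eq_comm (a := j)]
    split_ifs
    · exact Ring.inverse_mul_cancel _ (hq z j)
    · simp
  have hU : IsUnit A := isUnit_iff_exists_and_exists.2 ⟨⟨X, hX⟩, ⟨Y, hY⟩⟩
  refine ⟨hU, fun i j => ?_⟩
  have h1 : Ring.inverse A i j * quasidet A j i (B j i) = 1 := by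
    have h2 : A.mulVec (v j i) = Pi.single j (quasidet A j i (B j i)) := by
      funext r
      rw [Pi.single_apply, ← hv j i r]
      rfl
    have h3 := congrArg (fun u => (Ring.inverse A).mulVec u i) h2
    simp only [Matrix.mulVec_mulVec, Ring.inverse_mul_cancel _ hU, Matrix.one_mulVec, hv1] at h3
    rw [h3]
    simp
  calc Ring.inverse A i j = Ring.inverse A i j *
        (quasidet A j i (B j i) * Ring.inverse (quasidet A j i (B j i))) := by
          rw [Ring.mul_inverse_cancel _ (hq j i), mul_one]
    _ = _ := by rw [← mul_assoc, h1, one_mul]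
end

section
/- Noncommutative Gauss decomposition: Let R be a unital (possibly noncommutative) ring and G ∈ M_n(R) a matrix such that G is invertible and, for every 1 ≤ i < n, the trailing principal submatrix of G of size i (the submatrix on rows and columns n−i+1, …, n) is invertible over R. Then there exists a unique pair (U, A) of matrices in M_n(R) with U upper unitriangular (u^i_i = 1 and u^i_j = 0 for i > j) and A lower triangular (a^i_j = 0 for i < j) and invertible, such that G = UA; moreover every diagonal entry of A is invertible in R. -/
namespace GaussAux

variable {R : Type*} [Ring R] {n : ℕ}

/-- The trailing block of `M` from index `k` on, padded by the identity. -/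
def pad (M : Matrix (Fin n) (Fin n) R) (k : ℕ) : Matrix (Fin n) (Fin n) R :=
  fun i j => if k ≤ (i : ℕ) ∧ k ≤ (j : ℕ) then M i j else (1 : Matrix (Fin n) (Fin n) R) i j

def ext (k : ℕ) (S : Matrix {j : Fin n // k ≤ (j : ℕ)} {j : Fin n // k ≤ (j : ℕ)} R) :
    Matrix (Fin n) (Fin n) R :=
  fun i j => if h : k ≤ (i : ℕ) ∧ k ≤ (j : ℕ) then S ⟨i, h.1⟩ ⟨j, h.2⟩
    else (1 : Matrix (Fin n) (Fin n) R) i j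

lemma ext_one (k : ℕ) : ext (R := R) (n := n) k 1 = 1 := by
  ext i j
  simp [ext, Matrix.one_apply]

lemma ext_mul (k : ℕ) (S T : Matrix {j : Fin n // k ≤ (j : ℕ)} {j : Fin n // k ≤ (j : ℕ)} R) :
    ext k (S * T) = ext k S * ext k T := by
  ext i j
  rw [Matrix.mul_apply]
  by_cases hi : k ≤ (i : ℕ)
  · by_cases hj : k ≤ (j : ℕ)
    · rw [← Finset.sum_subset (Finset.subset_univ (Finset.univ.filter fun m : Fin n => k ≤ (m : ℕ)))]
      · rw [← Finset.sum_subtype_of_mem (p := fun m : Fin n => k ≤ (m : ℕ))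
          (fun m => ext k S i m * ext k T m j) (by simp)]
        simp only [ext, hi, hj, and_self, dite_true, Matrix.mul_apply]
        apply Finset.sum_congr
        · ext x; simpa using x.2
        · intro x _; simp [x.2]
      · intro m _ hm
        have hm' : ¬ k ≤ (m : ℕ) := by simpa using hm
        have : i ≠ m := by rintro rfl; exact hm' hi
        simp [ext, hm', Matrix.one_apply, this]
    · rw [Finset.sum_eq_single j]
      · simp [ext, hj]
      · intro m _ hm
        simp [ext, hj, Matrix.one_apply, hm]
      · simp
  · rw [Finset.sum_eq_single i]
    · simp [ext, hi]
    · intro m _ hm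
      simp [ext, hi, Matrix.one_apply, hm.symm]
    · simp

lemma pad_isUnit (G : Matrix (Fin n) (Fin n) R) (k : ℕ)
    (h : IsUnit (Matrix.of fun a b : {j : Fin n // k ≤ (j : ℕ)} => G a b)) :
    IsUnit (pad G k) := by
  have e : pad G k = ext k (Matrix.of fun a b : {j : Fin n // k ≤ (j : ℕ)} => G a b) := by
    ext i j; simp [pad, ext]
  obtain ⟨S, h1, h2⟩ := isUnit_iff_exists.1 h
  rw [e]
  refine isUnit_iff_exists.2 ⟨ext k S, ?_, ?_⟩
  · rw [← ext_mul, h1, ext_one]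
  · rw [← ext_mul, h2, ext_one]

/-- Upper unitriangular. -/
def UU (V : Matrix (Fin n) (Fin n) R) : Prop :=
  (∀ i, V i i = 1) ∧ ∀ i j, j < i → V i j = 0

lemma UU.isUnit {V : Matrix (Fin n) (Fin n) R} (h : UU V) : IsUnit V := by
  have key : ∀ (k : ℕ) (i j : Fin n), (j : ℕ) < i + k → ((V - 1) ^ k) i j = 0 := by
    intro k
    induction k with
    | zero =>
      intro i j hij
      have : i ≠ j := by rintro rfl; omega
      simp [Matrix.one_apply, this]
    | succ k ih =>
      intro i j hij
      rw [pow_succ, Matrix.mul_apply]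
      apply Finset.sum_eq_zero
      intro m _
      by_cases hm : (m : ℕ) < i + k
      · rw [ih i m hm, zero_mul]
      · have : (V - 1) m j = 0 := by
          rcases eq_or_ne m j with rfl | hne
          · simp [h.1]
          · have : j < m := by
              have : (m : ℕ) ≠ j := fun e => hne (Fin.ext e)
              rw [Fin.lt_def]; omega
            simp [h.2 m j this, Matrix.one_apply, hne]
        rw [this, mul_zero]
  have hn : IsNilpotent (V - 1) := ⟨n, by
    ext i j
    exact key n i j (by omega)⟩
  simpa using hn.isUnit_one_add

lemma UU.inv {V W : Matrix (Fin n) (Fin n) R} (h : UU V) (hVW : V * W = 1) : UU W := by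
  have row : ∀ i j : Fin n, (∀ m, i < m → W m j = 0) →
      W i j = (1 : Matrix (Fin n) (Fin n) R) i j := by
    intro i j hm
    rw [← hVW, Matrix.mul_apply, Finset.sum_eq_single i]
    · simp [h.1]
    · intro m _ hmi
      rcases lt_or_gt_of_ne hmi with h' | h'
      · simp [h.2 i m h']
      · simp [hm m h']
    · simp
  have z : ∀ (d : ℕ) (i j : Fin n), n ≤ i + d → j < i → W i j = 0 := by
    intro d
    induction d with
    | zero => intro i j h1; omega
    | succ d ih =>
      intro i j h1 h2
      rw [row i j]
      · simp [Matrix.one_apply, h2.ne']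
      · intro m hm
        exact ih m j (by have := Fin.lt_def.1 hm; omega) (h2.trans hm)
  refine ⟨fun i => ?_, fun i j hj => z n i j (by omega) hj⟩
  rw [row i i]
  · simp
  · intro m hm
    exact z n m i (by omega) hm

lemma UU.pad {V : Matrix (Fin n) (Fin n) R} (h : UU V) (k : ℕ) : UU (pad V k) := by
  refine ⟨fun i => ?_, fun i j hj => ?_⟩
  · simp [GaussAux.pad, h.1]
  · simp [GaussAux.pad, h.2 i j hj, Matrix.one_apply, hj.ne']

lemma pad_mul {V : Matrix (Fin n) (Fin n) R} (h : UU V) (G : Matrix (Fin n) (Fin n) R) (k : ℕ) :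
    pad (V * G) k = pad V k * pad G k := by
  ext i j
  rw [Matrix.mul_apply]
  by_cases hi : k ≤ (i : ℕ)
  · by_cases hj : k ≤ (j : ℕ)
    · simp only [pad, hi, hj, and_self, if_true, Matrix.mul_apply, true_and, and_true]
      apply Finset.sum_congr rfl
      intro m _
      by_cases hm : k ≤ (m : ℕ)
      · simp [hm]
      · have : m < i := by rw [Fin.lt_def]; omega
        simp [hm, h.2 i m this, Matrix.one_apply, this.ne']
    · rw [Finset.sum_eq_single j]
      · simp [pad, hj]
      · intro m _ hm
        simp [pad, hj, Matrix.one_apply, hm]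
      · simp
  · rw [Finset.sum_eq_single i]
    · simp [pad, hi]
    · intro m _ hm
      simp [pad, hi, Matrix.one_apply, hm.symm]
    · simp

/-- Uniqueness of row solutions. -/
lemma row_zero {G : Matrix (Fin n) (Fin n) R} {i : Fin n} (hG : IsUnit (pad G (i + 1)))
    (d : Fin n → R) (h0 : ∀ m, m ≤ i → d m = 0) (h1 : ∀ j, i < j → ∑ m, d m * G m j = 0) :
    d = 0 := by
  obtain ⟨H, hH, -⟩ := isUnit_iff_exists.1 hG
  have : Matrix.vecMul d (pad G (i + 1)) = 0 := by
    ext j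
    simp only [Matrix.vecMul, dotProduct, Pi.zero_apply]
    by_cases hj : i < j
    · rw [← h1 j hj]
      apply Finset.sum_congr rfl
      intro m _
      by_cases hm : m ≤ i
      · simp [h0 m hm]
      · have h2 : (i : ℕ) + 1 ≤ m := by have := Fin.lt_def.1 (not_le.1 hm); omega
        have h3 : (i : ℕ) + 1 ≤ j := by have := Fin.lt_def.1 hj; omega
        simp only [pad, h2, h3, and_self, if_true]
    · apply Finset.sum_eq_zero
      intro m _
      by_cases hm : m ≤ i
      · simp [h0 m hm]
      · have h3 : ¬ (i : ℕ) + 1 ≤ j := by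
          have := Fin.le_def.1 (not_lt.1 hj); omega
        have : m ≠ j := by rintro rfl; exact hm (not_lt.1 hj)
        simp only [pad, h3, and_false, if_false, Matrix.one_apply, this, mul_zero]
  calc d = Matrix.vecMul (Matrix.vecMul d (pad G (i + 1))) H := by
        rw [Matrix.vecMul_vecMul, hH, Matrix.vecMul_one]
    _ = 0 := by rw [this, Matrix.zero_vecMul]

lemma row_exists {G : Matrix (Fin n) (Fin n) R} {i : Fin n} (hG : IsUnit (pad G (i + 1))) :
    ∃ v : Fin n → R, v i = 1 ∧ (∀ m, m < i → v m = 0) ∧ ∀ j, i < j → ∑ m, v m * G m j = 0 := by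
  obtain ⟨H, -, hH⟩ := isUnit_iff_exists.1 hG
  let r : Fin n → R := fun j => if i < j then - G i j else 0
  let w := Matrix.vecMul r H
  have hw : Matrix.vecMul w (pad G (i + 1)) = r := by
    rw [Matrix.vecMul_vecMul, hH, Matrix.vecMul_one]
  have hw0 : ∀ j, j ≤ i → w j = 0 := by
    intro j hj
    have h3 : ¬ (i : ℕ) + 1 ≤ j := by have := Fin.le_def.1 hj; omega
    have := congrFun hw j
    simp only [Matrix.vecMul, dotProduct, pad, h3, and_false, if_false, r, hj.not_gt] at this
    simpa [Matrix.one_apply] using this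
  have hw1 : ∀ j, i < j → ∑ m, w m * G m j = - G i j := by
    intro j hj
    have := congrFun hw j
    simp only [r, hj, if_true] at this
    rw [← this]
    simp only [Matrix.vecMul, dotProduct]
    apply Finset.sum_congr rfl
    intro m _
    by_cases hm : m ≤ i
    · simp [hw0 m hm]
    · have h2 : (i : ℕ) + 1 ≤ m := by have := Fin.lt_def.1 (not_le.1 hm); omega
      have h3 : (i : ℕ) + 1 ≤ j := by have := Fin.lt_def.1 hj; omega
      simp only [pad, h2, h3, and_self, if_true]
  refine ⟨fun m => w m + if m = i then 1 else 0, ?_, ?_, ?_⟩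
  · simp [hw0]
  · intro m hm
    simp [hw0 m hm.le, hm.ne]
  · intro j hj
    simp [add_mul, Finset.sum_add_distrib, hw1 j hj]

lemma diag_unit {A : Matrix (Fin n) (Fin n) R} (hA : ∀ i j, i < j → A i j = 0) (k : Fin n)
    (h1 : IsUnit (pad A k)) (h2 : IsUnit (pad A (k + 1))) : IsUnit (A k k) := by
  obtain ⟨B, hB, hB'⟩ := isUnit_iff_exists.1 h1
  have low : ∀ i j, i < j → pad A k i j = 0 := by
    intro i j hij
    simp [pad, hA i j hij, Matrix.one_apply, hij.ne]
  have kk : pad A k k k = A k k := by simp [pad]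
  have colz : ∀ m, m < k → pad A k m k = 0 := fun m hm => low m k hm
  have e1 : A k k * B k k = 1 := by
    have := congrFun (congrFun hB k) k
    rw [Matrix.mul_apply, Finset.sum_eq_single k] at this
    · simpa [kk] using this
    · intro m _ hm
      rcases lt_or_gt_of_ne hm with h | h
      · have : ¬ (k : ℕ) ≤ m := by have := Fin.lt_def.1 h; omega
        simp [pad, this, Matrix.one_apply, hm.symm]
      · simp [low k m h]
    · simp
  have hd := row_zero h2 (fun m => if k < m then B k m else 0)
    (by intro m hm; simp [hm.not_gt]) (by
      intro j hj
      have := congrFun (congrFun hB' k) j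
      rw [Matrix.one_apply_ne hj.ne] at this
      refine Eq.trans ?_ this
      rw [Matrix.mul_apply]
      apply Finset.sum_congr rfl
      intro m _
      by_cases hm : k < m
      · have a1 : (k : ℕ) ≤ m := (Fin.lt_def.1 hm).le
        have a2 : (k : ℕ) ≤ j := (Fin.lt_def.1 hj).le
        simp only [pad, hm, a1, a2, and_self, if_true]
      · simp [hm, low m j ((not_lt.1 hm).trans_lt hj)])
  have e2 : B k k * A k k = 1 := by
    have := congrFun (congrFun hB' k) k
    rw [Matrix.mul_apply, Finset.sum_eq_single k] at this
    · simpa [kk] using this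
    · intro m _ hm
      rcases lt_or_gt_of_ne hm with h | h
      · simp [colz m h]
      · have := congrFun hd m
        simp only [h, if_true, Pi.zero_apply] at this
        simp [this]
    · simp
  exact isUnit_iff_exists.2 ⟨B k k, e1, e2⟩

end GaussAux

/-- **Noncommutative Gauss decomposition.** Let `R` be a unital, possibly noncommutative,
ring and `G ∈ M_n(R)` an invertible matrix all of whose trailing principal submatrices
(on the last `i` rows and columns, `1 ≤ i < n`) are invertible.  Then there is a unique
pair `(U, A)` with `U` upper unitriangular, `A` lower triangular and invertible, and
`G = U * A`; moreover every diagonal entry of `A` is invertible in `R`. -/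
theorem noncommutative_gauss_decomposition
    {R : Type*} [Ring R] {n : ℕ}
    (G : Matrix (Fin n) (Fin n) R) (hG : IsUnit G)
    (hprin : ∀ i : ℕ, 1 ≤ i → i < n →
      IsUnit (Matrix.of fun a b : {j : Fin n // n - i ≤ (j : ℕ)} => G a b)) :
    (∃! p : (Matrix (Fin n) (Fin n) R) × (Matrix (Fin n) (Fin n) R),
      (∀ i : Fin n, p.1 i i = 1) ∧ (∀ i j : Fin n, j < i → p.1 i j = 0) ∧
      (∀ i j : Fin n, i < j → p.2 i j = 0) ∧ IsUnit p.2 ∧ G = p.1 * p.2) ∧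
    (∀ U A : Matrix (Fin n) (Fin n) R,
      ((∀ i : Fin n, U i i = 1) ∧ (∀ i j : Fin n, j < i → U i j = 0) ∧
        (∀ i j : Fin n, i < j → A i j = 0) ∧ IsUnit A ∧ G = U * A) →
      ∀ i : Fin n, IsUnit (A i i)) := by
  have hpad : ∀ k : ℕ, k ≤ n → IsUnit (GaussAux.pad G k) := by
    intro k hk
    rcases Nat.eq_zero_or_pos k with rfl | hk0
    · have : GaussAux.pad G 0 = G := by ext i j; simp [GaussAux.pad]
      rwa [this]
    · rcases hk.eq_or_lt with rfl | hlt
      · have : GaussAux.pad G k = 1 := by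
          ext i j
          have : ¬ k ≤ (i : ℕ) := by omega
          simp [GaussAux.pad, this]
        rw [this]; exact isUnit_one
      · have := hprin (n - k) (by omega) (by omega)
        rw [show n - (n - k) = k by omega] at this
        exact GaussAux.pad_isUnit G k this
  have hex : ∀ i : Fin n, ∃ v : Fin n → R, v i = 1 ∧ (∀ m, m < i → v m = 0) ∧
      ∀ j, i < j → ∑ m, v m * G m j = 0 :=
    fun i => GaussAux.row_exists (hpad (i + 1) (by omega))
  choose V hV1 hV0 hVG using hex
  have hV : GaussAux.UU (Matrix.of V) := ⟨hV1, hV0⟩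
  obtain ⟨W, hVW, hWV⟩ := isUnit_iff_exists.1 hV.isUnit
  have hW : GaussAux.UU W := hV.inv hVW
  have uniq : ∀ U A : Matrix (Fin n) (Fin n) R,
      ((∀ i : Fin n, U i i = 1) ∧ (∀ i j : Fin n, j < i → U i j = 0) ∧
        (∀ i j : Fin n, i < j → A i j = 0) ∧ IsUnit A ∧ G = U * A) →
      U = W ∧ A = Matrix.of V * G := by
    rintro U A ⟨h1, h2, h3, -, h5⟩
    have hU : GaussAux.UU U := ⟨h1, h2⟩
    obtain ⟨X, hUX, hXU⟩ := isUnit_iff_exists.1 hU.isUnit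
    have hX : GaussAux.UU X := hU.inv hUX
    have hA : A = X * G := by rw [h5, ← mul_assoc, hXU, one_mul]
    have hXV : X = Matrix.of V := by
      ext i m
      have := GaussAux.row_zero (hpad (i + 1) (by omega)) (fun m => X i m - V i m) (by
        intro m hm
        rcases hm.eq_or_lt with rfl | hlt
        · simp [hX.1, hV1]
        · simp [hX.2 i m hlt, hV0 i m hlt]) (by
        intro j hj
        have := h3 i j hj
        rw [hA, Matrix.mul_apply] at this
        simp [sub_mul, Finset.sum_sub_distrib, this, hVG i j hj])
      exact sub_eq_zero.1 (congrFun this m)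
    rw [hXV] at hUX hA
    refine ⟨?_, hA⟩
    calc U = U * (Matrix.of V * W) := by rw [hVW, mul_one]
      _ = W := by rw [← mul_assoc, hUX, one_mul]
  have hlow : ∀ i j : Fin n, i < j → (Matrix.of V * G) i j = 0 := by
    intro i j hij
    rw [Matrix.mul_apply]
    exact hVG i j hij
  refine ⟨⟨(W, Matrix.of V * G), ⟨hW.1, hW.2, hlow, hV.isUnit.mul hG, ?_⟩, ?_⟩, ?_⟩
  · change G = W * (Matrix.of V * G)
    rw [← mul_assoc, hWV, one_mul]
  · rintro ⟨U, A⟩ h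
    obtain ⟨e1, e2⟩ := uniq U A h
    rw [e1, e2]
  · intro U A h i
    obtain ⟨-, rfl⟩ := uniq U A h
    have hp : ∀ k : ℕ, k ≤ n → IsUnit (GaussAux.pad (Matrix.of V * G) k) := by
      intro k hk
      rw [GaussAux.pad_mul hV]
      exact (hV.pad k).isUnit.mul (hpad k hk)
    exact GaussAux.diag_unit hlow i (hp i (by omega)) (hp (i + 1) (by omega))
end

section
/- Coaction of a block-triangular matrix on a Schur complement: Let k be a field, E and B unital associative k-algebras, and ρ : E → E ⊗ B a k-algebra homomorphism. Fix p, m ≥ 1 and matrices a ∈ M_{p×p}(E), b ∈ M_{p×m}(E), c ∈ M_{m×p}(E), d ∈ M_{m×m}(E), and 𝔞 ∈ M_{p×p}(B), 𝔠 ∈ M_{m×p}(B), 𝔡 ∈ M_{m×m}(B). Assume the entrywise identities ρ(a^i_j) = Σ_k a^i_k ⊗ 𝔞^k_j + Σ_l b^i_l ⊗ 𝔠^l_j, ρ(b^i_j) = Σ_l b^i_l ⊗ 𝔡^l_j, ρ(c^i_j) = Σ_k c^i_k ⊗ 𝔞^k_j + Σ_l d^i_l ⊗ 𝔠^l_j,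 and ρ(d^i_j) = Σ_l d^i_l ⊗ 𝔡^l_j. If d is invertible in M_m(E) and 𝔡 is invertible in M_m(B), then the Schur complement a − b·d⁻¹·c satisfies ρ((a − bd⁻¹c)^i_j) = Σ_k (a − bd⁻¹c)^i_k ⊗ 𝔞^k_j for all i, j. -/
open scoped TensorProduct

/-- **Coaction of a block-triangular matrix on a Schur complement.** Let `k` be a field,
`E`, `B` unital `k`-algebras and `ρ : E → E ⊗ B` a `k`-algebra homomorphism.  Given
blocks `a, b, c, d` over `E` and `𝔞, 𝔠, 𝔡` over `B` satisfying the entrywise coaction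
identities of a block lower-triangular comatrix, with `d` and `𝔡` invertible, the Schur
complement `a − b·d⁻¹·c` satisfies
`ρ((a − b·d⁻¹·c)^i_j) = Σ_k (a − b·d⁻¹·c)^i_k ⊗ 𝔞^k_j`. -/
theorem schur_complement_coaction
    {k : Type*} [Field k]
    {E : Type*} [Ring E] [Algebra k E] {B : Type*} [Ring B] [Algebra k B]
    (ρ : E →ₐ[k] E ⊗[k] B)
    {p m : ℕ} (hp : 1 ≤ p) (hm : 1 ≤ m)
    (a : Matrix (Fin p) (Fin p) E) (b : Matrix (Fin p) (Fin m) E)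
    (c : Matrix (Fin m) (Fin p) E) (d : Matrix (Fin m) (Fin m) E)
    (fa : Matrix (Fin p) (Fin p) B) (fc : Matrix (Fin m) (Fin p) B)
    (fd : Matrix (Fin m) (Fin m) B)
    (ha : ∀ (i j : Fin p),
      ρ (a i j) = (∑ x : Fin p, a i x ⊗ₜ[k] fa x j) + ∑ l : Fin m, b i l ⊗ₜ[k] fc l j)
    (hb : ∀ (i : Fin p) (j : Fin m), ρ (b i j) = ∑ l : Fin m, b i l ⊗ₜ[k] fd l j)
    (hc : ∀ (i : Fin m) (j : Fin p),
      ρ (c i j) = (∑ x : Fin p, c i x ⊗ₜ[k] fa x j) + ∑ l : Fin m, d i l ⊗ₜ[k] fc l j)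
    (hd : ∀ (i j : Fin m), ρ (d i j) = ∑ l : Fin m, d i l ⊗ₜ[k] fd l j)
    (hdinv : IsUnit d) (hfdinv : IsUnit fd) :
    ∀ (i j : Fin p),
      ρ ((a - b * Ring.inverse d * c) i j)
        = ∑ x : Fin p, (a - b * Ring.inverse d * c) i x ⊗ₜ[k] fa x j := by
  let L : E →ₐ[k] E ⊗[k] B := Algebra.TensorProduct.includeLeft
  let R : B →ₐ[k] E ⊗[k] B := Algebra.TensorProduct.includeRight
  have hLR : ∀ x y, x ⊗ₜ[k] y = L x * R y := by
    intro x y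
    simp [L, R]
  have Ha : a.map ρ = a.map L * fa.map R + b.map L * fc.map R := by
    ext i j
    simp [Matrix.mul_apply, ha, hLR]
  have Hb : b.map ρ = b.map L * fd.map R := by
    ext i j
    simp [Matrix.mul_apply, hb, hLR]
  have Hc : c.map ρ = c.map L * fa.map R + d.map L * fc.map R := by
    ext i j
    simp [Matrix.mul_apply, hc, hLR]
  have Hd : d.map ρ = d.map L * fd.map R := by
    ext i j
    simp [Matrix.mul_apply, hd, hLR]
  have hed : Ring.inverse d * d = 1 := Ring.inverse_mul_cancel d hdinv
  have hde : d * Ring.inverse d = 1 := Ring.mul_inverse_cancel d hdinv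
  have hfg : fd * Ring.inverse fd = 1 := Ring.mul_inverse_cancel fd hfdinv
  generalize Ring.inverse d = e at *
  generalize Ring.inverse fd = g at *
  have hde' : d.map L * e.map L = 1 := by
    rw [← Matrix.map_mul, hde, Matrix.map_one _ (map_zero L) (map_one L)]
  have hfg' : fd.map R * g.map R = 1 := by
    rw [← Matrix.map_mul, hfg, Matrix.map_one _ (map_zero R) (map_one R)]
  have hbed : b * e * d = b := by rw [Matrix.mul_assoc, hed, Matrix.mul_one]
  have h1 : (b * e).map ρ * (d.map L * fd.map R) = b.map L * fd.map R := by
    rw [← Hd, ← Hb, ← Matrix.map_mul, hbed]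
  have h2 : (b * e).map ρ = (b * e).map L := by
    have h3 := congrArg (fun X => X * g.map R * e.map L) h1
    simp only [Matrix.mul_assoc] at h3
    rw [← Matrix.mul_assoc (fd.map R), hfg', Matrix.one_mul, hde', Matrix.mul_one] at h3
    rw [h3, Matrix.map_mul]
  have h4 : (b * e).map L * d.map L = b.map L := by
    rw [← Matrix.map_mul, hbed]
  have h5 : (a - b * e * c).map ρ = (a - b * e * c).map L * fa.map R := by
    rw [Matrix.map_sub _ (map_sub ρ), Matrix.map_sub _ (map_sub L), Matrix.map_mul (M := c),
      Matrix.map_mul (M := c), h2, Ha, Hc, Matrix.mul_add, ← Matrix.mul_assoc,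
      ← Matrix.mul_assoc, h4, Matrix.sub_mul]
    abel
  intro i j
  have h6 := congrFun (congrFun h5 i) j
  rw [Matrix.map_apply, Matrix.mul_apply] at h6
  rw [h6]
  simp only [hLR, Matrix.map_apply]
end
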